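/- arXiv:2205.14291 — 2 statements merged into one kernel-verified Lean document; each statement's English description precedes it below -/
import Mathlib

section
/- There exist constants C > 0 and q > 0 depending only on n with the following property: if u is continuous on B₁⁺ ∪ T₁, harmonic on B₁⁺, u ≥ 0 on B₁⁺, u = 0 on T₁, and u(eₙ/2) = 1, then u(x₀) ≤ C·(x₀ₙ)^(−q) for every x₀ ∈ B₃⸝₄⁺, where x₀ₙ denotes the n-th coordinate of x₀. -/
noncomputable section

/-- The Laplacian of `u : ℝⁿ → ℝ`. -/
def lapl {m : ℕ} (u : EuclideanSpace ℝ (Fin m) → ℝ) (x : EuclideanSpace ℝ (Fin m)) : ℝ :=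
  ∑ i : Fin m, fderiv ℝ (fun y => fderiv ℝ u y (EuclideanSpace.single i 1)) x
    (EuclideanSpace.single i 1)

/-- Harmonic on an open set: C² with vanishing Laplacian. -/
def IsHarmonicOn {m : ℕ} (u : EuclideanSpace ℝ (Fin m) → ℝ)
    (U : Set (EuclideanSpace ℝ (Fin m))) : Prop :=
  ContDiffOn ℝ 2 u U ∧ ∀ x ∈ U, lapl u x = 0

/-- The unit vector `eₙ` in dimension `n + 2`. -/
def en (n : ℕ) : EuclideanSpace ℝ (Fin (n + 2)) := EuclideanSpace.single (Fin.last (n + 1)) 1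

/-- The upper half ball `B_r⁺`. -/
def halfBall (n : ℕ) (r : ℝ) : Set (EuclideanSpace ℝ (Fin (n + 2))) :=
  {x | ‖x‖ < r ∧ 0 < x (Fin.last (n + 1))}

/-- The flat boundary part `T_r`. -/
def flatT (n : ℕ) (r : ℝ) : Set (EuclideanSpace ℝ (Fin (n + 2))) :=
  {x | ‖x‖ < r ∧ x (Fin.last (n + 1)) = 0}

open MeasureTheory Metric Set Filter Topology

/-- The square of the positive part is differentiable. -/
lemma hasDerivAt_max_zero_sq (t : ℝ) :
    HasDerivAt (fun t : ℝ => max t 0 ^ 2) (2 * max t 0) t := by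
  rcases lt_trichotomy t 0 with h | h | h
  · rw [max_eq_right h.le, mul_zero]
    refine (hasDerivAt_const t (0 : ℝ)).congr_of_eventuallyEq ?_
    filter_upwards [Iio_mem_nhds h] with s hs
    simp [max_eq_right (mem_Iio.1 hs).le]
  · subst h
    rw [hasDerivAt_iff_isLittleO]
    simp only [max_self, sub_zero, smul_eq_mul, mul_zero, ne_eq, OfNat.ofNat_ne_zero,
      not_false_eq_true, zero_pow]
    refine (Asymptotics.isBigO_of_le _ fun s => ?_).trans_isLittleO
      (Asymptotics.isLittleO_pow_id one_lt_two)
    simp only [norm_pow]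
    gcongr
    simp only [Real.norm_eq_abs]
    rw [abs_of_nonneg (le_max_right _ _)]
    exact max_le (le_abs_self s) (abs_nonneg s)
  · rw [max_eq_left h.le]
    have := hasDerivAt_pow 2 t
    simp only [Nat.cast_ofNat, Nat.add_one_sub_one, pow_one] at this
    refine this.congr_of_eventuallyEq ?_
    filter_upwards [Ioi_mem_nhds h] with s hs
    rw [max_eq_left (mem_Ioi.1 hs).le]

variable {m : ℕ}

/-- The radial averaging weight `(1 - |y|²)₊`. -/
def weight (y : EuclideanSpace ℝ (Fin m)) : ℝ := max (1 - ‖y‖ ^ 2) 0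

/-- A radial potential of the averaging weight: its gradient at `y` is `-(weight y) y`. -/
def weightPotential (y : EuclideanSpace ℝ (Fin m)) : ℝ := weight y ^ 2 / 4

lemma weight_nonneg (y : EuclideanSpace ℝ (Fin m)) : 0 ≤ weight y := le_max_right _ _

lemma weight_le_one (y : EuclideanSpace ℝ (Fin m)) : weight y ≤ 1 :=
  max_le (by linarith [sq_nonneg ‖y‖]) zero_le_one

lemma weight_eq_zero {y : EuclideanSpace ℝ (Fin m)} (hy : 1 ≤ ‖y‖) : weight y = 0 :=
  max_eq_right (by nlinarith)

lemma continuous_weight : Continuous (weight (m := m)) := by unfold weight; fun_prop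

lemma hasCompactSupport_weight : HasCompactSupport (weight (m := m)) :=
  HasCompactSupport.of_support_subset_isCompact (isCompact_closedBall 0 1) fun y hy => by
    by_contra h
    exact hy (weight_eq_zero (by simpa using (not_le.1 (by simpa using h)).le))

lemma integral_weight_pos : 0 < ∫ y, weight (m := m) y :=
  continuous_weight.integral_pos_of_hasCompactSupport_nonneg_nonzero hasCompactSupport_weight
    weight_nonneg (x := 0) (by simp [weight])

lemma hasFDerivAt_weightPotential (y : EuclideanSpace ℝ (Fin m)) :
    HasFDerivAt weightPotential (-(weight y) • innerSL ℝ y) y := by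
  have h1 : HasFDerivAt (fun y : EuclideanSpace ℝ (Fin m) => 1 - ‖y‖ ^ 2)
      (-(2 • innerSL ℝ y)) y := by
    simpa using (hasStrictFDerivAt_norm_sq y).hasFDerivAt.const_sub 1
  have h2 := ((hasDerivAt_max_zero_sq (1 - ‖y‖ ^ 2)).comp_hasFDerivAt y h1).mul_const (1 / 4 : ℝ)
  refine (h2.congr_fderiv ?_).congr_of_eventuallyEq ?_
  · ext z
    simp [weight]
    ring
  · filter_upwards with z
    simp [weightPotential, weight, div_eq_mul_inv]

lemma fderiv_weightPotential_single (y : EuclideanSpace ℝ (Fin m)) (i : Fin m) :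
    fderiv ℝ weightPotential y (EuclideanSpace.single i 1) = -(weight y * y i) := by
  rw [(hasFDerivAt_weightPotential y).fderiv]
  simp [EuclideanSpace.inner_single_right]

lemma continuous_weightPotential : Continuous (weightPotential (m := m)) :=
  (continuous_weight.pow 2).div_const 4

lemma hasCompactSupport_weightPotential : HasCompactSupport (weightPotential (m := m)) :=
  hasCompactSupport_weight.mono fun y hy h => hy (by simp [weightPotential, h])

/-- Integration by parts: the weighted flux of a `C²` function is a weighted integral of its
Laplacian. -/
lemma integral_fderiv_apply_self_mul_weight {v : EuclideanSpace ℝ (Fin m) → ℝ}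
    (hv : ContDiff ℝ 2 v) (x : EuclideanSpace ℝ (Fin m)) (s : ℝ) :
    ∫ y, fderiv ℝ v (x + s • y) y * weight y =
      s * ∫ y, lapl v (x + s • y) * weightPotential y := by
  have hd (i : Fin m) : ContDiff ℝ 1 fun z => fderiv ℝ v z (EuclideanSpace.single i 1) :=
    (hv.fderiv_right (m := 1) le_rfl).clm_apply contDiff_const
  have haff : Differentiable ℝ fun y : EuclideanSpace ℝ (Fin m) => x + s • y := by fun_prop
  have hchain (i : Fin m) (y : EuclideanSpace ℝ (Fin m)) :
      fderiv ℝ (fun y => fderiv ℝ v (x + s • y) (EuclideanSpace.single i 1)) y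
        (EuclideanSpace.single i 1) =
      s * fderiv ℝ (fun z => fderiv ℝ v z (EuclideanSpace.single i 1)) (x + s • y)
        (EuclideanSpace.single i 1) := by
    have h1 : HasFDerivAt (fun y : EuclideanSpace ℝ (Fin m) => x + s • y)
        (s • ContinuousLinearMap.id ℝ _) y :=
      ((hasFDerivAt_id y).const_smul s).const_add x
    have h2 := (((hd i).differentiable one_ne_zero) (x + s • y)).hasFDerivAt.comp y h1
    have h3 := h2.fderiv
    simp only [Function.comp_def] at h3
    rw [h3]
    simp
  have hcont2 (i : Fin m) : Continuous fun y => fderiv ℝ (fun z => fderiv ℝ v z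
      (EuclideanSpace.single i 1)) (x + s • y) (EuclideanSpace.single i 1) :=
    (((hd i).continuous_fderiv one_ne_zero).comp haff.continuous).clm_apply continuous_const
  have hint2 (i : Fin m) : Integrable fun y => fderiv ℝ (fun z => fderiv ℝ v z
      (EuclideanSpace.single i 1)) (x + s • y) (EuclideanSpace.single i 1) * weightPotential y :=
    ((hcont2 i).mul continuous_weightPotential).integrable_of_hasCompactSupport
      hasCompactSupport_weightPotential.mul_left
  have hc1 (i : Fin m) : Continuous fun y => fderiv ℝ v (x + s • y) (EuclideanSpace.single i 1) :=
    (hd i).continuous.comp haff.continuous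
  have hint1 (i : Fin m) : Integrable fun y => fderiv ℝ v (x + s • y)
      (EuclideanSpace.single i 1) * (weight y * y i) :=
    ((hc1 i).mul (continuous_weight.mul (by fun_prop))).integrable_of_hasCompactSupport
      hasCompactSupport_weight.mul_right.mul_left
  have hparts (i : Fin m) :
      ∫ y, fderiv ℝ v (x + s • y) (EuclideanSpace.single i 1) * (weight y * y i) =
      ∫ y, s * (fderiv ℝ (fun z => fderiv ℝ v z
      (EuclideanSpace.single i 1)) (x + s • y) (EuclideanSpace.single i 1) *
        weightPotential y) := by
    have h := integral_mul_fderiv_eq_neg_fderiv_mul_of_integrable (μ := volume)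
      (f := fun y => fderiv ℝ v (x + s • y) (EuclideanSpace.single i 1))
      (g := weightPotential) (v := EuclideanSpace.single i 1)
      (by simpa only [hchain, mul_assoc] using (hint2 i).const_mul s)
      (by simp only [fderiv_weightPotential_single, mul_neg]; exact (hint1 i).neg)
      (((hc1 i).mul continuous_weightPotential).integrable_of_hasCompactSupport
        hasCompactSupport_weightPotential.mul_left)
      (fun y _ => (((hd i).differentiable one_ne_zero).comp haff) y)
      (fun y _ => (hasFDerivAt_weightPotential y).differentiableAt)
    simpa only [fderiv_weightPotential_single, mul_neg, integral_neg, neg_inj, hchain,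
      mul_assoc] using h
  calc ∫ y, fderiv ℝ v (x + s • y) y * weight y
      = ∫ y, ∑ i, fderiv ℝ v (x + s • y) (EuclideanSpace.single i 1) * (weight y * y i) := by
        congr 1 with y
        have hy : y = ∑ i, y i • EuclideanSpace.single i (1 : ℝ) := by
          simpa using ((EuclideanSpace.basisFun (Fin m) ℝ).sum_repr y).symm
        conv_lhs => enter [1, 2]; rw [hy]
        rw [map_sum, Finset.sum_mul]
        refine Finset.sum_congr rfl fun i _ => ?_
        rw [map_smul, smul_eq_mul]
        ring
    _ = ∑ i, ∫ y, s * (fderiv ℝ (fun z => fderiv ℝ v z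
          (EuclideanSpace.single i 1)) (x + s • y) (EuclideanSpace.single i 1) *
          weightPotential y) := by
        rw [integral_finsetSum _ fun i _ => hint1 i]
        exact Finset.sum_congr rfl fun i _ => hparts i
    _ = s * ∫ y, lapl v (x + s • y) * weightPotential y := by
        rw [← integral_finsetSum _ fun i _ => (hint2 i).const_mul s, ← integral_const_mul]
        simp only [lapl, Finset.sum_mul, Finset.mul_sum]

/-- The weighted mean value property. -/
lemma integral_mul_weight_eq {v : EuclideanSpace ℝ (Fin m) → ℝ}
    (hv : ContDiff ℝ 2 v) (hvc : HasCompactSupport v) {x : EuclideanSpace ℝ (Fin m)} {R r : ℝ}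
    (hr : 0 ≤ r) (hrR : r ≤ R) (hl : ∀ z ∈ ball x R, lapl v z = 0) :
    ∫ y, v (x + r • y) * weight y = v x * ∫ y, weight (m := m) y := by
  obtain ⟨M, hM⟩ := (hvc.fderiv (𝕜 := ℝ)).exists_bound_of_continuous
    (hv.continuous_fderiv two_ne_zero)
  have hM0 : 0 ≤ M := (norm_nonneg _).trans (hM x)
  have hderiv (s : ℝ) : HasDerivAt (fun s => ∫ y, v (x + s • y) * weight y)
      (∫ y, fderiv ℝ v (x + s • y) y * weight y) s := by
    refine (hasDerivAt_integral_of_dominated_loc_of_deriv_le (μ := volume)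
      (F := fun s y => v (x + s • y) * weight y)
      (F' := fun s y => fderiv ℝ v (x + s • y) y * weight y) (bound := fun y => M * weight y)
      (s := univ) univ_mem (.of_forall fun s => ?_) ?_ ?_ (.of_forall fun y s _ => ?_) ?_
      (.of_forall fun y s _ => ?_)).2
    · have := hv.continuous
      have := continuous_weight (m := m)
      exact Continuous.aestronglyMeasurable (by fun_prop)
    · have := hv.continuous
      have := continuous_weight (m := m)
      exact Continuous.integrable_of_hasCompactSupport (by fun_prop)
        hasCompactSupport_weight.mul_left
    · have := hv.continuous_fderiv two_ne_zero
      have := continuous_weight (m := m)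
      exact Continuous.aestronglyMeasurable (by fun_prop)
    · rcases le_or_gt 1 ‖y‖ with hy | hy
      · simp [weight_eq_zero hy]
      · rw [norm_mul, Real.norm_of_nonneg (weight_nonneg y)]
        gcongr
        · exact weight_nonneg y
        · calc ‖fderiv ℝ v (x + s • y) y‖ ≤ ‖fderiv ℝ v (x + s • y)‖ * ‖y‖ :=
              ContinuousLinearMap.le_opNorm _ _
            _ ≤ M * 1 := by gcongr; exact hM _
            _ = M := mul_one M
    · exact (continuous_weight.integrable_of_hasCompactSupport
        hasCompactSupport_weight).const_mul M
    · have h1 : HasDerivAt (fun s : ℝ => x + s • y) y s := by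
        simpa using ((hasDerivAt_id s).smul_const y).const_add x
      exact ((hv.differentiable two_ne_zero (x + s • y)).hasFDerivAt.comp_hasDerivAt s
        h1).mul_const _
  have hzero (s : ℝ) (hs : s ∈ Ico 0 r) : ∫ y, fderiv ℝ v (x + s • y) y * weight y = 0 := by
    rw [integral_fderiv_apply_self_mul_weight hv]
    refine mul_eq_zero_of_right _ (integral_eq_zero_of_ae (.of_forall fun y => ?_))
    rcases le_or_gt 1 ‖y‖ with hy | hy
    · simp [weightPotential, weight_eq_zero hy]
    · have : x + s • y ∈ ball x R := by
        rw [mem_ball_iff_norm, add_sub_cancel_left, norm_smul, Real.norm_of_nonneg hs.1]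
        nlinarith [hs.1, hs.2, norm_nonneg y]
      simp [hl _ this]
  have := constant_of_has_deriv_right_zero (a := 0) (b := r)
    (HasDerivAt.continuousOn fun s _ => hderiv s)
    (fun s hs => (hzero s hs ▸ hderiv s).hasDerivWithinAt) r ⟨hr, le_rfl⟩
  simpa [integral_const_mul] using this

/-- The weighted mean value property, with the weight rescaled. -/
lemma mul_integral_weight_eq {v : EuclideanSpace ℝ (Fin m) → ℝ}
    (hv : ContDiff ℝ 2 v) (hvc : HasCompactSupport v) {x : EuclideanSpace ℝ (Fin m)} {R r : ℝ}
    (hr : 0 < r) (hrR : r ≤ R) (hl : ∀ z ∈ ball x R, lapl v z = 0) :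
    ∫ z, v z * weight (r⁻¹ • (z - x)) = r ^ m * (v x * ∫ y, weight (m := m) y) := by
  rw [← integral_mul_weight_eq hv hvc hr.le hrR hl]
  have h1 := Measure.integral_comp_inv_smul (volume : Measure (EuclideanSpace ℝ (Fin m)))
    (fun y => v (x + r • y) * weight y) r
  rw [finrank_euclideanSpace_fin, abs_of_pos (by positivity), smul_eq_mul] at h1
  rw [← h1, ← integral_add_left_eq_self (fun z => v z * weight (r⁻¹ • (z - x))) x]
  simp [smul_smul, hr.ne']

/-- Multiplying by a bump function extends a harmonic function on a neighbourhood of a closed ball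
to a compactly supported `C²` function. -/
lemma exists_contDiff_extension {u : EuclideanSpace ℝ (Fin m) → ℝ} {y : EuclideanSpace ℝ (Fin m)}
    {ρ R : ℝ} (hρ : 0 < ρ) (hρR : ρ < R) (hu : IsHarmonicOn u (ball y R))
    (hu0 : ∀ z ∈ ball y R, 0 ≤ u z) :
    ∃ v : EuclideanSpace ℝ (Fin m) → ℝ, ContDiff ℝ 2 v ∧ HasCompactSupport v ∧ (∀ z, 0 ≤ v z) ∧
      (∀ z ∈ ball y ρ, v z = u z) ∧ ∀ z ∈ ball y ρ, lapl v z = 0 := by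
  let χ : ContDiffBump y := ⟨ρ, (ρ + R) / 2, hρ, by linarith⟩
  have hsupp : ∀ z ∉ ball y R, z ∉ tsupport χ := fun z hz h => by
    rw [χ.tsupport_eq] at h
    exact hz (closedBall_subset_ball (by change (ρ + R) / 2 < R; linarith) h)
  have heq (z) (hz : z ∈ ball y ρ) : (fun w => χ w * u w) =ᶠ[𝓝 z] u := by
    filter_upwards [χ.eventuallyEq_one_of_mem_ball hz] with w hw
    simp [hw]
  refine ⟨fun z => χ z * u z, contDiff_iff_contDiffAt.2 fun z => ?_, χ.hasCompactSupport.mul_right,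
    fun z => ?_, fun z hz => (heq z hz).eq_of_nhds, fun z hz => ?_⟩
  · by_cases hz : z ∈ ball y R
    · exact χ.contDiffAt.mul (hu.1.contDiffAt (isOpen_ball.mem_nhds hz))
    · refine (contDiffAt_const (c := (0 : ℝ))).congr_of_eventuallyEq ?_
      filter_upwards [notMem_tsupport_iff_eventuallyEq.1 (hsupp z hz)] with w hw
      simp [hw]
  · by_cases hz : z ∈ ball y R
    · exact mul_nonneg χ.nonneg (hu0 z hz)
    · simp [image_eq_zero_of_notMem_tsupport (hsupp z hz)]
  · rw [← hu.2 z (ball_subset_ball hρR.le hz)]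
    refine Finset.sum_congr rfl fun i _ => ?_
    have : (fun w => fderiv ℝ (fun w => χ w * u w) w (EuclideanSpace.single i 1)) =ᶠ[𝓝 z]
        fun w => fderiv ℝ u w (EuclideanSpace.single i 1) := by
      filter_upwards [(heq z hz).fderiv (𝕜 := ℝ)] with w hw
      rw [hw]
    rw [this.fderiv_eq]

/-- **Harnack inequality** for nonnegative harmonic functions. -/
lemma IsHarmonicOn.harnack {u : EuclideanSpace ℝ (Fin m) → ℝ} {x y : EuclideanSpace ℝ (Fin m)}
    {r R : ℝ} (hu : IsHarmonicOn u (ball y R)) (hu0 : ∀ z ∈ ball y R, 0 ≤ u z) (hr : 0 < r)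
    (hrR : 3 * r < R) (hxy : dist x y ≤ r) : u x ≤ 2 * 3 ^ m * u y := by
  obtain ⟨v, hv, hvc, hv0, hvu, hvl⟩ :=
    exists_contDiff_extension (by positivity) hrR hu hu0
  have hx := mul_integral_weight_eq hv hvc (x := x) hr le_rfl fun z hz => hvl z <| by
    rw [mem_ball] at hz ⊢
    linarith [dist_triangle z x y]
  have hy := mul_integral_weight_eq hv hvc (x := y) (by positivity : 0 < 3 * r) le_rfl hvl
  have hint (c : ℝ) (hc : 0 < c) (w : EuclideanSpace ℝ (Fin m)) :
      Integrable fun z => v z * weight (c⁻¹ • (z - w)) := by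
    have := hv.continuous
    have := continuous_weight (m := m)
    exact Continuous.integrable_of_hasCompactSupport (by fun_prop) hvc.mul_right
  have hweight (z : EuclideanSpace ℝ (Fin m)) :
      weight (r⁻¹ • (z - x)) ≤ 2 * weight ((3 * r)⁻¹ • (z - y)) := by
    rcases le_or_gt 1 ‖r⁻¹ • (z - x)‖ with h | h
    · rw [weight_eq_zero h]
      linarith [weight_nonneg ((3 * r)⁻¹ • (z - y))]
    · refine (weight_le_one _).trans ?_
      rw [norm_smul, norm_inv, Real.norm_of_nonneg hr.le, inv_mul_lt_iff₀ hr, ← dist_eq_norm] at h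
      have h2 : ‖(3 * r)⁻¹ • (z - y)‖ ≤ 2 / 3 := by
        rw [norm_smul, norm_inv, Real.norm_of_nonneg (by positivity),
          inv_mul_le_iff₀ (by positivity), ← dist_eq_norm]
        linarith [dist_triangle z x y]
      have h3 : 1 - ‖(3 * r)⁻¹ • (z - y)‖ ^ 2 ≤ weight ((3 * r)⁻¹ • (z - y)) := le_max_left _ _
      nlinarith [norm_nonneg ((3 * r)⁻¹ • (z - y))]
  have hle : ∫ z, v z * weight (r⁻¹ • (z - x)) ≤
      ∫ z, 2 * (v z * weight ((3 * r)⁻¹ • (z - y))) :=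
    integral_mono (hint r hr x) ((hint (3 * r) (by positivity) y).const_mul 2) fun z => by
      nlinarith [mul_le_mul_of_nonneg_left (hweight z) (hv0 z)]
  rw [integral_const_mul, hx, hy, hvu x (by rw [mem_ball]; linarith),
    hvu y (by simp [hr]), mul_pow] at hle
  have hpos : 0 < r ^ m * ∫ y, weight (m := m) y := mul_pos (by positivity) integral_weight_pos
  refine le_of_mul_le_mul_right ?_ hpos
  linarith

lemma ball_subset_halfBall {n : ℕ} {y : EuclideanSpace ℝ (Fin (n + 2))} {ρ : ℝ}
    (h1 : ‖y‖ + ρ ≤ 1) (h2 : ρ ≤ y (Fin.last (n + 1))) : ball y ρ ⊆ halfBall n 1 := by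
  intro z hz
  rw [mem_ball_iff_norm] at hz
  have h3 := PiLp.norm_apply_le (z - y) (Fin.last (n + 1))
  rw [PiLp.sub_apply, Real.norm_eq_abs] at h3
  exact ⟨by linarith [norm_le_norm_add_norm_sub' z y], by linarith [neg_le_of_abs_le h3]⟩

/-- The Harnack inequality in the unit half ball. -/
lemma IsHarmonicOn.harnack_halfBall {n : ℕ} {u : EuclideanSpace ℝ (Fin (n + 2)) → ℝ}
    (hu : IsHarmonicOn u (halfBall n 1)) (hu0 : ∀ x ∈ halfBall n 1, 0 ≤ u x)
    {x y : EuclideanSpace ℝ (Fin (n + 2))} {r R : ℝ} (hr : 0 < r) (hrR : 3 * r < R)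
    (hxy : dist x y ≤ r) (h1 : ‖y‖ + R ≤ 1) (h2 : R ≤ y (Fin.last (n + 1))) :
    u x ≤ 2 * 3 ^ (n + 2) * u y := by
  have hsub := ball_subset_halfBall h1 h2
  exact IsHarmonicOn.harnack ⟨hu.1.mono hsub, fun z hz => hu.2 z (hsub hz)⟩
    (fun z hz => hu0 z (hsub hz)) hr hrR hxy

/-- The iterated Harnack inequality along the segment from `x₀` to `eₙ / 2`. -/
lemma IsHarmonicOn.le_pow_mul_of_pow_le {n : ℕ} {u : EuclideanSpace ℝ (Fin (n + 2)) → ℝ}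
    (hu : IsHarmonicOn u (halfBall n 1)) (hu0 : ∀ x ∈ halfBall n 1, 0 ≤ u x)
    {x₀ : EuclideanSpace ℝ (Fin (n + 2))} (hx₀ : x₀ ∈ halfBall n (3 / 4)) {k : ℕ}
    (hk : (9 / 10 : ℝ) ^ k < x₀ (Fin.last (n + 1)) / 12) :
    u x₀ ≤ (2 * 3 ^ (n + 2)) ^ (k + 1) * u ((2⁻¹ : ℝ) • en n) := by
  obtain ⟨hx1, hx2⟩ := hx₀
  set h := x₀ (Fin.last (n + 1)) with hh
  set p : EuclideanSpace ℝ (Fin (n + 2)) := (2⁻¹ : ℝ) • en n with hp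
  let P : ℝ → EuclideanSpace ℝ (Fin (n + 2)) := fun τ => τ • p + (1 - τ) • x₀
  have hpn : ‖p‖ = 1 / 2 := by simp [hp, en, norm_smul]
  have hpl : p (Fin.last (n + 1)) = 1 / 2 := by simp [hp, en]
  clear_value p
  have hh1 : h < 3 / 4 :=
    ((le_abs_self h).trans (PiLp.norm_apply_le x₀ (Fin.last (n + 1)))).trans_lt hx1
  have hpx : ‖p - x₀‖ ≤ 5 / 4 := by linarith [norm_sub_le p x₀]
  have hPn {τ : ℝ} (h0 : 0 ≤ τ) (h1 : τ ≤ 1) : ‖P τ‖ ≤ τ / 2 + (1 - τ) * (3 / 4) := by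
    refine (norm_add_le _ _).trans ?_
    rw [norm_smul, norm_smul, Real.norm_of_nonneg h0, Real.norm_of_nonneg (by linarith), hpn]
    nlinarith
  have hPl (τ : ℝ) : P τ (Fin.last (n + 1)) = τ / 2 + (1 - τ) * h := by
    simp [P, hpl, ← hh]
    ring
  have hPd {σ τ : ℝ} (hστ : σ ≤ τ) : dist (P σ) (P τ) ≤ (τ - σ) * (5 / 4) := by
    have : P τ - P σ = (τ - σ) • (p - x₀) := by simp only [P]; module
    rw [dist_comm, dist_eq_norm, this, norm_smul, Real.norm_of_nonneg (by linarith)]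
    gcongr
  have hchain (j : ℕ) : u (P ((9 / 10) ^ j)) ≤ (2 * 3 ^ (n + 2)) ^ j * u p := by
    induction j with
    | zero => simp [P]
    | succ j ih =>
      have hτ0 : (0 : ℝ) < (9 / 10) ^ j := by positivity
      have hτ1 : (9 / 10 : ℝ) ^ j ≤ 1 := pow_le_one₀ (by norm_num) (by norm_num)
      rw [pow_succ (9 / 10 : ℝ)]
      generalize (9 / 10 : ℝ) ^ j = τ at *
      have := hu.harnack_halfBall hu0 (x := P (τ * (9 / 10))) (y := P τ) (r := τ / 8)
        (R := τ / 2) (by linarith) (by linarith) ((hPd (by linarith)).trans (by linarith))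
        (by linarith [hPn hτ0.le hτ1]) (by rw [hPl]; nlinarith)
      refine this.trans ?_
      rw [pow_succ' (2 * 3 ^ (n + 2) : ℝ), mul_assoc (2 * 3 ^ (n + 2) : ℝ)]
      gcongr
  have hτ0 : (0 : ℝ) < (9 / 10) ^ k := by positivity
  have hfirst : u x₀ ≤ 2 * 3 ^ (n + 2) * u (P ((9 / 10) ^ k)) := by
    generalize (9 / 10 : ℝ) ^ k = τ at *
    have hP0 : P 0 = x₀ := by simp [P]
    rw [← hP0]
    exact hu.harnack_halfBall hu0 (r := τ * (5 / 4)) (R := h / 3) (by positivity) (by linarith)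
      ((hPd hτ0.le).trans (by linarith)) (by linarith [hPn hτ0.le (by linarith)])
      (by rw [hPl]; nlinarith)
  refine hfirst.trans ?_
  rw [pow_succ' (2 * 3 ^ (n + 2) : ℝ), mul_assoc (2 * 3 ^ (n + 2) : ℝ)]
  gcongr
  exact hchain k

theorem growth_estimate_vertical_chain (n : ℕ) :
    ∃ C q : ℝ, 0 < C ∧ 0 < q ∧
      ∀ u : EuclideanSpace ℝ (Fin (n + 2)) → ℝ,
        ContinuousOn u (halfBall n 1 ∪ flatT n 1) →
        IsHarmonicOn u (halfBall n 1) →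
        (∀ x ∈ halfBall n 1, 0 ≤ u x) →
        (∀ x ∈ flatT n 1, u x = 0) →
        u ((2⁻¹ : ℝ) • en n) = 1 →
        ∀ x₀ ∈ halfBall n (3 / 4), u x₀ ≤ C * x₀ (Fin.last (n + 1)) ^ (-q) := by
  set K : ℝ := 2 * 3 ^ (n + 2) with hK
  have hK1 : 1 < K := by
    have : (1 : ℝ) ≤ 3 ^ (n + 2) := one_le_pow₀ (by norm_num)
    linarith
  have hK0 : 0 < K := by linarith
  have hlog : 0 < Real.log (10 / 9) := Real.log_pos (by norm_num)
  set q : ℝ := Real.log K / Real.log (10 / 9) with hq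
  have hq0 : 0 < q := div_pos (Real.log_pos hK1) hlog
  have hKq : (9 / 10 : ℝ) ^ (-q) = K := by
    rw [Real.rpow_def_of_pos (by norm_num), show (9 / 10 : ℝ) = (10 / 9)⁻¹ by norm_num,
      Real.log_inv, neg_mul_neg, hq, mul_div_cancel₀ _ hlog.ne', Real.exp_log hK0]
  refine ⟨K ^ 2 * 12 ^ q, q, by positivity, hq0, fun u _ hu hu0 _ hu1 x₀ hx₀ => ?_⟩
  have hh : 0 < x₀ (Fin.last (n + 1)) := hx₀.2
  have hh1 : x₀ (Fin.last (n + 1)) < 3 / 4 :=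
    ((le_abs_self _).trans (PiLp.norm_apply_le x₀ (Fin.last (n + 1)))).trans_lt hx₀.1
  obtain ⟨k, hk1, hk2⟩ := exists_nat_pow_near_of_lt_one
    (x := x₀ (Fin.last (n + 1)) / 12) (y := (9 / 10 : ℝ)) (by positivity) (by linarith)
    (by norm_num) (by norm_num)
  have hle := hu.le_pow_mul_of_pow_le hu0 hx₀ hk1
  rw [hu1, mul_one, ← hK] at hle
  have hKk : K ^ k ≤ 12 ^ q * x₀ (Fin.last (n + 1)) ^ (-q) := by
    calc K ^ k = ((9 / 10 : ℝ) ^ k) ^ (-q) := by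
          rw [← hKq, ← Real.rpow_mul_natCast (by norm_num), mul_comm,
            Real.rpow_natCast_mul (by norm_num)]
      _ ≤ (x₀ (Fin.last (n + 1)) / 12) ^ (-q) :=
          Real.rpow_le_rpow_of_nonpos (by positivity) hk2 (by linarith)
      _ = 12 ^ q * x₀ (Fin.last (n + 1)) ^ (-q) := by
          rw [Real.div_rpow hh.le (by norm_num), Real.rpow_neg (by norm_num : (0 : ℝ) ≤ 12),
            div_inv_eq_mul, mul_comm]
  calc u x₀ ≤ K ^ (k + 1 + 1) := hle
    _ = K ^ 2 * K ^ k := by ring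
    _ ≤ K ^ 2 * (12 ^ q * x₀ (Fin.last (n + 1)) ^ (-q)) := by gcongr
    _ = K ^ 2 * 12 ^ q * x₀ (Fin.last (n + 1)) ^ (-q) := by ring
end
end

section
/- Let u be continuous on the closed half-space {x ∈ ℝⁿ : xₙ ≥ 0}, harmonic on the open half-space {xₙ > 0}, with u ≥ 0 on {xₙ ≥ 0} and u = 0 on the hyperplane {xₙ = 0}. Then u(x) = u(eₙ)·xₙ for every x with xₙ ≥ 0. -/
noncomputable section

open MeasureTheory Filter Topology Set

theorem hasDerivAt_max_zero_pow {k : ℕ} (hk : k ≠ 0) (s : ℝ) :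
    HasDerivAt (fun s : ℝ => max s 0 ^ (k + 1)) ((k + 1) * max s 0 ^ k) s := by
  rcases lt_trichotomy s 0 with hs | rfl | hs
  · have h : (fun s : ℝ => max s 0 ^ (k + 1)) =ᶠ[𝓝 s] fun _ => 0 := by
      filter_upwards [Iio_mem_nhds hs] with y hy
      simp [max_eq_right (mem_Iio.1 hy).le]
    rw [max_eq_right hs.le, zero_pow hk, mul_zero]
    exact (hasDerivAt_const s (0 : ℝ)).congr_of_eventuallyEq h
  · have hc : Tendsto (fun y : ℝ => max y 0 ^ k) (𝓝[≠] 0) (𝓝 0) := by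
      have : Continuous fun y : ℝ => max y 0 ^ k := by fun_prop
      simpa [hk] using (this.tendsto 0).mono_left nhdsWithin_le_nhds
    rw [hasDerivAt_iff_tendsto_slope, max_self, zero_pow hk, mul_zero]
    refine hc.congr' ?_
    filter_upwards [self_mem_nhdsWithin] with y (hy : y ≠ 0)
    rcases le_total y 0 with h | h
    · simp [slope, max_eq_right h, hk]
    · simp only [slope, max_eq_left h, sub_zero, vsub_eq_sub, max_self, smul_eq_mul, ne_eq,
        Nat.succ_ne_zero, not_false_eq_true, zero_pow]
      field_simp
      rw [pow_succ]
  · have h : (fun s : ℝ => max s 0 ^ (k + 1)) =ᶠ[𝓝 s] fun s => s ^ (k + 1) := by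
      filter_upwards [Ioi_mem_nhds hs] with y hy
      rw [max_eq_left (mem_Ioi.1 hy).le]
    rw [max_eq_left hs.le]
    simpa using (hasDerivAt_pow (k + 1) s).congr_of_eventuallyEq h

theorem contDiff_max_zero_pow_four : ContDiff ℝ 2 fun s : ℝ => max s 0 ^ 4 := by
  have h4 : deriv (fun s : ℝ => max s 0 ^ 4) = fun s => 4 * max s 0 ^ 3 := by
    ext s
    simpa using ((hasDerivAt_max_zero_pow (k := 3) (by simp) s).deriv.trans (by norm_num))
  have h3 : deriv (fun s : ℝ => max s 0 ^ 3) = fun s => 3 * max s 0 ^ 2 := by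
    ext s
    simpa using ((hasDerivAt_max_zero_pow (k := 2) (by simp) s).deriv.trans (by norm_num))
  rw [show (2 : WithTop ℕ∞) = 1 + 1 by norm_num, contDiff_succ_iff_deriv]
  refine ⟨fun s => (hasDerivAt_max_zero_pow (k := 3) (by simp) s).differentiableAt, by simp, ?_⟩
  rw [h4]
  refine contDiff_const.mul (contDiff_one_iff_deriv.2
    ⟨fun s => (hasDerivAt_max_zero_pow (k := 2) (by simp) s).differentiableAt, ?_⟩)
  rw [h3]
  fun_prop

theorem integrable_mul_of_tsupport_subset {m : ℕ} {U : Set (EuclideanSpace ℝ (Fin m))}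
    {f g : EuclideanSpace ℝ (Fin m) → ℝ} (hf : ContinuousOn f U) (hg : Continuous g)
    (hc : HasCompactSupport g) (hU : tsupport g ⊆ U) : Integrable fun y => f y * g y := by
  have h : IntegrableOn (fun y => f y * g y) (tsupport g) :=
    ((hf.mono hU).mul hg.continuousOn).integrableOn_compact hc
  refine (integrableOn_iff_integrable_of_support_subset fun y hy => ?_).1 h
  exact subset_tsupport _ (right_ne_zero_of_mul hy)

theorem contDiffOn_fderiv_apply {m : ℕ} {U : Set (EuclideanSpace ℝ (Fin m))} (hU : IsOpen U)
    {u : EuclideanSpace ℝ (Fin m) → ℝ} (hu : ContDiffOn ℝ 2 u U) (v : EuclideanSpace ℝ (Fin m)) :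
    ContDiffOn ℝ 1 (fun y => fderiv ℝ u y v) U :=
  (hu.fderiv_of_isOpen hU (m := 1) (by norm_num)).clm_apply contDiffOn_const

theorem contDiff_fderiv_apply {m : ℕ} {u : EuclideanSpace ℝ (Fin m) → ℝ} (hu : ContDiff ℝ 2 u)
    (v : EuclideanSpace ℝ (Fin m)) : ContDiff ℝ 1 (fun y => fderiv ℝ u y v) :=
  contDiffOn_univ.1 (contDiffOn_fderiv_apply isOpen_univ hu.contDiffOn v)

theorem continuous_lapl {m : ℕ} {φ : EuclideanSpace ℝ (Fin m) → ℝ} (hφ : ContDiff ℝ 2 φ) :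
    Continuous (lapl φ) :=
  continuous_finsetSum _ fun i _ =>
    ((contDiff_fderiv_apply hφ _).continuous_fderiv (by norm_num)).clm_apply continuous_const

theorem tsupport_lapl_subset {m : ℕ} (φ : EuclideanSpace ℝ (Fin m) → ℝ) :
    tsupport (lapl φ) ⊆ tsupport φ := by
  refine closure_minimal (fun y hy => ?_) (isClosed_tsupport φ)
  by_contra h
  refine hy (Finset.sum_eq_zero fun i _ => ?_)
  have h1 : y ∉ tsupport (fun y => fderiv ℝ φ y (EuclideanSpace.single i 1)) :=
    fun h' => h (tsupport_fderiv_apply_subset ℝ _ h')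
  have h2 : y ∉ tsupport (fun x => fderiv ℝ (fun y => fderiv ℝ φ y (EuclideanSpace.single i 1)) x
      (EuclideanSpace.single i 1)) := fun h' => h1 (tsupport_fderiv_apply_subset ℝ _ h')
  have h3 := image_eq_zero_of_notMem_tsupport h2
  exact h3

/-- Green's identity for a harmonic function tested against a compactly supported function. -/
theorem IsHarmonicOn.integral_mul_lapl_eq_zero {m : ℕ} {U : Set (EuclideanSpace ℝ (Fin m))}
    (hU : IsOpen U) {u φ : EuclideanSpace ℝ (Fin m) → ℝ} (hu : IsHarmonicOn u U)
    (hφ : ContDiff ℝ 2 φ) (hc : HasCompactSupport φ) (hs : tsupport φ ⊆ U) :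
    ∫ y, u y * lapl φ y = 0 := by
  obtain ⟨hu2, hu0⟩ := hu
  set e : Fin m → EuclideanSpace ℝ (Fin m) := fun i => EuclideanSpace.single i 1 with he
  have hs1 (i) : tsupport (fun y => fderiv ℝ φ y (e i)) ⊆ tsupport φ :=
    tsupport_fderiv_apply_subset ℝ _
  have hc1 (i) : HasCompactSupport fun y => fderiv ℝ φ y (e i) := hc.of_isClosed_subset
    (isClosed_tsupport _) (hs1 i)
  have hφ1 (i) := contDiff_fderiv_apply hφ (e i)
  have hu1 (i) := contDiffOn_fderiv_apply hU hu2 (e i)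
  have hs2 (i) : tsupport (fun y => fderiv ℝ (fun y => fderiv ℝ φ y (e i)) y (e i)) ⊆ tsupport φ :=
    (tsupport_fderiv_apply_subset ℝ _).trans (hs1 i)
  have hc2 (i) : HasCompactSupport fun y => fderiv ℝ (fun y => fderiv ℝ φ y (e i)) y (e i) :=
    hc.of_isClosed_subset (isClosed_tsupport _) (hs2 i)
  have hφ2 (i) : Continuous fun y => fderiv ℝ (fun y => fderiv ℝ φ y (e i)) y (e i) :=
    ((hφ1 i).continuous_fderiv (by norm_num)).clm_apply continuous_const
  have hu2' (i) : ContinuousOn (fun y => fderiv ℝ (fun y => fderiv ℝ u y (e i)) y (e i)) U :=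
    ((hu1 i).continuousOn_fderiv_of_isOpen hU le_rfl).clm_apply continuousOn_const
  have key (i) : ∫ y, u y * fderiv ℝ (fun y => fderiv ℝ φ y (e i)) y (e i) =
      ∫ y, fderiv ℝ (fun y => fderiv ℝ u y (e i)) y (e i) * φ y := by
    rw [integral_mul_fderiv_eq_neg_fderiv_mul_of_integrable,
      integral_mul_fderiv_eq_neg_fderiv_mul_of_integrable, neg_neg]
    · exact integrable_mul_of_tsupport_subset (hu2' i) hφ.continuous hc hs
    · exact integrable_mul_of_tsupport_subset (hu1 i).continuousOn (hφ1 i).continuous (hc1 i)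
        ((hs1 i).trans hs)
    · exact integrable_mul_of_tsupport_subset (hu1 i).continuousOn hφ.continuous hc hs
    · exact fun x hx => ((hu1 i).differentiableOn (by norm_num)).differentiableAt
        (hU.mem_nhds (hs hx))
    · exact fun x _ => (hφ.differentiable (by norm_num)) x
    · exact integrable_mul_of_tsupport_subset (hu1 i).continuousOn (hφ1 i).continuous (hc1 i)
        ((hs1 i).trans hs)
    · exact integrable_mul_of_tsupport_subset hu2.continuousOn (hφ2 i) (hc2 i) ((hs2 i).trans hs)
    · exact integrable_mul_of_tsupport_subset hu2.continuousOn (hφ1 i).continuous (hc1 i)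
        ((hs1 i).trans hs)
    · exact fun x hx => (hu2.differentiableOn (by norm_num)).differentiableAt
        (hU.mem_nhds (hs (hs1 i hx)))
    · exact fun x _ => ((hφ1 i).differentiable (by norm_num)) x
  have hint (i) : Integrable fun y => u y * fderiv ℝ (fun y => fderiv ℝ φ y (e i)) y (e i) :=
    integrable_mul_of_tsupport_subset hu2.continuousOn (hφ2 i) (hc2 i) ((hs2 i).trans hs)
  have hint' (i) : Integrable fun y => fderiv ℝ (fun y => fderiv ℝ u y (e i)) y (e i) * φ y :=
    integrable_mul_of_tsupport_subset (hu2' i) hφ.continuous hc hs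
  calc ∫ y, u y * lapl φ y
      = ∑ i, ∫ y, u y * fderiv ℝ (fun y => fderiv ℝ φ y (e i)) y (e i) := by
        simp only [lapl, Finset.mul_sum]
        exact integral_finsetSum _ fun i _ => hint i
    _ = ∫ y, lapl u y * φ y := by
        simp only [key, lapl, Finset.sum_mul]
        exact (integral_finsetSum _ fun i _ => hint' i).symm
    _ = 0 := by
        refine integral_eq_zero_of_ae (Eventually.of_forall fun y => ?_)
        by_cases hy : y ∈ tsupport φ
        · simp [hu0 y (hs hy)]
        · simp [image_eq_zero_of_notMem_tsupport hy]

theorem lapl_comp_apply_mul {m : ℕ} (j : Fin m) {h : ℝ → ℝ} (hh : ContDiff ℝ 2 h)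
    {ψ : EuclideanSpace ℝ (Fin m) → ℝ} (hψ : ContDiff ℝ 2 ψ) (y : EuclideanSpace ℝ (Fin m)) :
    lapl (fun y => h (y j) * ψ y) y = h (y j) * lapl ψ y +
      2 * deriv h (y j) * fderiv ℝ ψ y (EuclideanSpace.single j 1) +
      deriv (deriv h) (y j) * ψ y := by
  have hh1 : ContDiff ℝ 1 (deriv h) := by
    have : ContDiff ℝ (1 + 1) h := by simpa [one_add_one_eq_two] using hh
    exact (contDiff_succ_iff_deriv.1 this).2.2
  have hp (y : EuclideanSpace ℝ (Fin m)) : HasFDerivAt (fun y : EuclideanSpace ℝ (Fin m) => y j)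
      (EuclideanSpace.proj (𝕜 := ℝ) j : EuclideanSpace ℝ (Fin m) →L[ℝ] ℝ) y :=
    (EuclideanSpace.proj (𝕜 := ℝ) j : EuclideanSpace ℝ (Fin m) →L[ℝ] ℝ).hasFDerivAt
  have hd (g : ℝ → ℝ) (hg : ContDiff ℝ 1 g) (y : EuclideanSpace ℝ (Fin m)) :
      HasFDerivAt (fun y : EuclideanSpace ℝ (Fin m) => g (y j))
        (deriv g (y j) • (EuclideanSpace.proj (𝕜 := ℝ) j : EuclideanSpace ℝ (Fin m) →L[ℝ] ℝ)) y :=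
    ((hg.differentiable (by norm_num)) (y j)).hasDerivAt.comp_hasFDerivAt y (hp y)
  have h1 (i : Fin m) : (fun y => fderiv ℝ (fun y => h (y j) * ψ y) y (EuclideanSpace.single i 1)) =
      fun y => h (y j) * fderiv ℝ ψ y (EuclideanSpace.single i 1) +
        ψ y * (deriv h (y j) * if j = i then 1 else 0) := by
    ext y
    rw [((hd h (hh.of_le (by norm_num)) y).fun_mul
      ((hψ.differentiable (by norm_num)) y).hasFDerivAt).fderiv]
    simp [PiLp.single_apply]
  have h2 (i : Fin m) : fderiv ℝ (fun y => fderiv ℝ (fun y => h (y j) * ψ y) y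
      (EuclideanSpace.single i 1)) y (EuclideanSpace.single i 1) =
      h (y j) * fderiv ℝ (fun y => fderiv ℝ ψ y (EuclideanSpace.single i 1)) y
        (EuclideanSpace.single i 1) + if j = i then
      2 * deriv h (y j) * fderiv ℝ ψ y (EuclideanSpace.single i 1) +
      deriv (deriv h) (y j) * ψ y else 0 := by
    rw [h1, (((hd h (hh.of_le (by norm_num)) y).fun_mul
      (((contDiff_fderiv_apply hψ _).differentiable (by norm_num)) y).hasFDerivAt).fun_add
      (((hψ.differentiable (by norm_num)) y).hasFDerivAt.fun_mul
        ((hd _ hh1 y).mul_const _))).fderiv]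
    by_cases hij : j = i
    · simp [hij]
      ring
    · simp [hij]
  simp only [lapl, h2, Finset.sum_add_distrib, Finset.mul_sum, Finset.sum_ite_eq,
    Finset.mem_univ, if_true]
  ring

theorem exists_deriv_smoothTransition_bound : ∃ A : ℝ, 0 ≤ A ∧ ∀ s,
    |deriv Real.smoothTransition s| ≤ A ∧ |deriv (deriv Real.smoothTransition) s| ≤ A := by
  have h2 : ContDiff ℝ 2 Real.smoothTransition := Real.smoothTransition.contDiff (n := 2)
  have h1 : ContDiff ℝ 1 (deriv Real.smoothTransition) := by
    have : ContDiff ℝ (1 + 1) Real.smoothTransition := by simpa [one_add_one_eq_two] using h2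
    exact (contDiff_succ_iff_deriv.1 this).2.2
  have hc1 : HasCompactSupport (deriv Real.smoothTransition) := by
    refine HasCompactSupport.of_support_subset_isCompact (isCompact_Icc (a := 0) (b := 1)) ?_
    intro s hs
    by_contra hs'
    rw [mem_Icc, not_and_or, not_le, not_le] at hs'
    apply hs
    rcases hs' with h | h
    · have : Real.smoothTransition =ᶠ[𝓝 s] fun _ => 0 := by
        filter_upwards [Iio_mem_nhds h] with y hy
        exact Real.smoothTransition.zero_of_nonpos (mem_Iio.1 hy).le
      rw [this.deriv_eq, deriv_const]
    · have : Real.smoothTransition =ᶠ[𝓝 s] fun _ => 1 := by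
        filter_upwards [Ioi_mem_nhds h] with y hy
        exact Real.smoothTransition.one_of_one_le (mem_Ioi.1 hy).le
      rw [this.deriv_eq, deriv_const]
  obtain ⟨A, hA⟩ := hc1.exists_bound_of_continuous h1.continuous
  obtain ⟨B, hB⟩ := hc1.deriv.exists_bound_of_continuous (h1.continuous_deriv le_rfl)
  refine ⟨max A B, ((norm_nonneg _).trans (hA 0)).trans (le_max_left _ _), fun s => ?_⟩
  exact ⟨(hA s).trans (le_max_left _ _), (hB s).trans (le_max_right _ _)⟩

/-- Cutoffs in one variable that vanish up to `ε` and equal one from `2ε` on. -/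
theorem exists_cutoff : ∃ A : ℝ, 0 ≤ A ∧ ∀ ε > 0, ∃ h : ℝ → ℝ, ContDiff ℝ 2 h ∧
    (∀ s ≤ ε, h s = 0) ∧ (∀ s, 2 * ε ≤ s → h s = 1) ∧ (∀ s, 0 ≤ h s ∧ h s ≤ 1) ∧
    (∀ s, |deriv h s| ≤ A / ε) ∧ ∀ s, |deriv (deriv h) s| ≤ A / ε ^ 2 := by
  obtain ⟨A, hA0, hA⟩ := exists_deriv_smoothTransition_bound
  refine ⟨A, hA0, fun ε hε => ⟨fun s => Real.smoothTransition (ε⁻¹ * s - 1), ?_, ?_, ?_, ?_, ?_⟩⟩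
  · exact (Real.smoothTransition.contDiff (n := 2)).comp
      ((contDiff_const.mul contDiff_id).sub contDiff_const)
  · intro s hs
    refine Real.smoothTransition.zero_of_nonpos ?_
    rw [sub_nonpos, inv_mul_le_iff₀ hε]
    linarith
  · intro s hs
    refine Real.smoothTransition.one_of_one_le ?_
    rw [le_sub_iff_add_le, le_inv_mul_iff₀ hε]
    linarith
  · exact fun s => ⟨Real.smoothTransition.nonneg _, Real.smoothTransition.le_one _⟩
  have hd (g : ℝ → ℝ) (hg : Differentiable ℝ g) :
      deriv (fun s => g (ε⁻¹ * s - 1)) = fun s => deriv g (ε⁻¹ * s - 1) * ε⁻¹ := by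
    ext s
    have h1 : HasDerivAt (fun s => ε⁻¹ * s - 1) ε⁻¹ s := by
      simpa using ((hasDerivAt_id s).const_mul ε⁻¹).sub_const 1
    exact ((hg _).hasDerivAt.comp s h1).deriv
  have h2 : ContDiff ℝ 2 Real.smoothTransition := Real.smoothTransition.contDiff (n := 2)
  have h1 : ContDiff ℝ 1 (deriv Real.smoothTransition) := by
    have : ContDiff ℝ (1 + 1) Real.smoothTransition := by simpa [one_add_one_eq_two] using h2
    exact (contDiff_succ_iff_deriv.1 this).2.2
  have e1 := hd _ (h2.differentiable (by norm_num))
  have e2 := hd _ (h1.differentiable (by norm_num))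
  constructor
  · intro s
    rw [e1, abs_mul, abs_of_pos (inv_pos.2 hε), ← div_eq_mul_inv]
    gcongr
    exact (hA _).1
  · intro s
    rw [e1, deriv_mul_const_field, e2, abs_mul, abs_mul, abs_of_pos (inv_pos.2 hε),
      ← div_eq_mul_inv, ← div_eq_mul_inv, div_div, ← sq]
    gcongr
    exact (hA _).2

theorem volume_slab_le {m : ℕ} (j : Fin (m + 1)) {a b R : ℝ} (hab : a ≤ b) (hR : 0 ≤ R) :
    volume.real {y : EuclideanSpace ℝ (Fin (m + 1)) | a ≤ y j ∧ y j ≤ b ∧ ‖y‖ ≤ R} ≤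
      (b - a) * (2 * R) ^ m := by
  classical
  set l : Fin (m + 1) → ℝ := Function.update (fun _ => -R) j a with hl
  set r : Fin (m + 1) → ℝ := Function.update (fun _ => R) j b with hr
  have hsub : {y : EuclideanSpace ℝ (Fin (m + 1)) | a ≤ y j ∧ y j ≤ b ∧ ‖y‖ ≤ R} ⊆
      WithLp.ofLp ⁻¹' (Icc l r) := by
    rintro y ⟨h1, h2, h3⟩
    have h4 (i) : |y i| ≤ R := (PiLp.norm_apply_le y i).trans h3
    constructor <;> intro i <;> by_cases hi : i = j
    · subst hi; simpa [hl]
    · simpa [hl, hi] using (abs_le.1 (h4 i)).1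
    · subst hi; simpa [hr]
    · simpa [hr, hi] using (abs_le.1 (h4 i)).2
  have hvol : volume (WithLp.ofLp ⁻¹' (Icc l r) : Set (EuclideanSpace ℝ (Fin (m + 1)))) =
      volume (Icc l r) :=
    (PiLp.volume_preserving_ofLp (Fin (m + 1))).measure_preimage measurableSet_Icc.nullMeasurableSet
  have hlr : l ≤ r := by
    intro i
    by_cases hi : i = j
    · subst hi; simpa [hl, hr]
    · simp [hl, hr, hi]; linarith
  calc volume.real {y : EuclideanSpace ℝ (Fin (m + 1)) | a ≤ y j ∧ y j ≤ b ∧ ‖y‖ ≤ R}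
      ≤ volume.real (WithLp.ofLp ⁻¹' (Icc l r) : Set (EuclideanSpace ℝ (Fin (m + 1)))) :=
        measureReal_mono hsub (by rw [hvol]; exact isCompact_Icc.measure_lt_top.ne)
    _ = ∏ i, (r i - l i) := by
        rw [measureReal_def, hvol, Real.volume_Icc_pi_toReal hlr]
    _ = (b - a) * (2 * R) ^ m := by
        rw [← Finset.mul_prod_erase _ _ (Finset.mem_univ j)]
        have : ∀ i ∈ Finset.univ.erase j, r i - l i = 2 * R := by
          intro i hi
          simp [hl, hr, Finset.ne_of_mem_erase hi]
          ring
        rw [Finset.prod_congr rfl this]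
        simp [hl, hr]

theorem norm_smul_en (n : ℕ) (c : ℝ) : ‖c • en n‖ = |c| := by
  simp [norm_smul, en]

theorem en_last (n : ℕ) : en n (Fin.last (n + 1)) = 1 := by
  simp [en]

theorem exists_small_near_boundary {n : ℕ} {u : EuclideanSpace ℝ (Fin (n + 2)) → ℝ}
    (hcont : ContinuousOn u {x | 0 ≤ x (Fin.last (n + 1))})
    (hbd : ∀ x : EuclideanSpace ℝ (Fin (n + 2)), x (Fin.last (n + 1)) = 0 → u x = 0)
    (R : ℝ) {δ : ℝ} (hδ : 0 < δ) :
    ∃ ε > 0, ∀ y : EuclideanSpace ℝ (Fin (n + 2)), 0 ≤ y (Fin.last (n + 1)) →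
      y (Fin.last (n + 1)) ≤ 2 * ε → ‖y‖ ≤ R → |u y| ≤ δ := by
  set K : Set (EuclideanSpace ℝ (Fin (n + 2))) :=
    Metric.closedBall 0 (2 * R) ∩ {x | 0 ≤ x (Fin.last (n + 1))} with hK
  have hKc : IsCompact K := (isCompact_closedBall _ _).inter_right
    (isClosed_le continuous_const (by fun_prop))
  have huc := hKc.uniformContinuousOn_of_continuous (hcont.mono inter_subset_right)
  obtain ⟨η, hη, h⟩ := Metric.uniformContinuousOn_iff.1 huc δ hδ
  refine ⟨η / 4, by positivity, fun y hy0 hy1 hyR => ?_⟩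
  have hyL : |y (Fin.last (n + 1))| ≤ R := (PiLp.norm_apply_le y _).trans hyR
  set z := y - y (Fin.last (n + 1)) • en n with hz
  have hz0 : z (Fin.last (n + 1)) = 0 := by simp [hz, en_last]
  have hyK : y ∈ K := ⟨by simp; linarith [norm_nonneg y], hy0⟩
  have hzK : z ∈ K := by
    refine ⟨?_, hz0.ge⟩
    rw [mem_closedBall_zero_iff]
    have := norm_sub_le y (y (Fin.last (n + 1)) • en n)
    rw [norm_smul_en] at this
    linarith
  have hdist : dist y z < η := by
    rw [dist_eq_norm, hz, sub_sub_cancel, norm_smul_en, abs_of_nonneg hy0]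
    linarith
  have := h y hyK z hzK hdist
  rw [hbd z hz0, Real.dist_eq, sub_zero] at this
  exact this.le

theorem isOpen_setOf_pos_apply {m : ℕ} (j : Fin m) :
    IsOpen {y : EuclideanSpace ℝ (Fin m) | 0 < y j} :=
  isOpen_lt continuous_const (by fun_prop)

theorem integrableOn_mul_of_hasCompactSupport {n : ℕ} {u g : EuclideanSpace ℝ (Fin (n + 2)) → ℝ}
    (hcont : ContinuousOn u {x | 0 ≤ x (Fin.last (n + 1))}) (hg : Continuous g)
    (hc : HasCompactSupport g) :
    IntegrableOn (fun y => u y * g y) {y | 0 < y (Fin.last (n + 1))} := by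
  have hcl : IsClosed {x : EuclideanSpace ℝ (Fin (n + 2)) | 0 ≤ x (Fin.last (n + 1))} :=
    isClosed_le continuous_const (by fun_prop)
  have h : IntegrableOn (fun y => u y * g y)
      ({x | 0 ≤ x (Fin.last (n + 1))} ∩ tsupport g) :=
    ((hcont.mono inter_subset_left).mul hg.continuousOn).integrableOn_compact
      (hc.isCompact.inter_left hcl)
  have h' : IntegrableOn (fun y => u y * g y) {x | 0 ≤ x (Fin.last (n + 1))} :=
    h.of_forall_sdiff_eq_zero hcl.measurableSet fun y hy => by
      have : y ∉ tsupport g := fun hy' => hy.2 ⟨hy.1, hy'⟩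
      simp [image_eq_zero_of_notMem_tsupport this]
  exact h'.mono_set fun y (hy : 0 < y (Fin.last (n + 1))) => hy.le

theorem abs_le_mul_of_lipschitzWith {n : ℕ} {ψ : EuclideanSpace ℝ (Fin (n + 2)) → ℝ} {C : NNReal}
    (hC : LipschitzWith C ψ)
    (hψ0 : ∀ y : EuclideanSpace ℝ (Fin (n + 2)), y (Fin.last (n + 1)) = 0 → ψ y = 0)
    (y : EuclideanSpace ℝ (Fin (n + 2))) : |ψ y| ≤ C * |y (Fin.last (n + 1))| := by
  have := hC.dist_le_mul y (y - y (Fin.last (n + 1)) • en n)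
  rwa [hψ0 (y - y (Fin.last (n + 1)) • en n) (by simp [en_last]), Real.dist_eq, sub_zero,
    dist_eq_norm, sub_sub_cancel, norm_smul_en] at this

/-- Green's identity up to the boundary hyperplane, on which both functions vanish. -/
theorem setIntegral_mul_lapl_eq_zero {n : ℕ} {u ψ : EuclideanSpace ℝ (Fin (n + 2)) → ℝ}
    (hcont : ContinuousOn u {x | 0 ≤ x (Fin.last (n + 1))})
    (hharm : IsHarmonicOn u {x | 0 < x (Fin.last (n + 1))})
    (hbd : ∀ x : EuclideanSpace ℝ (Fin (n + 2)), x (Fin.last (n + 1)) = 0 → u x = 0)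
    (hψ : ContDiff ℝ 2 ψ) (hc : HasCompactSupport ψ)
    (hψ0 : ∀ x : EuclideanSpace ℝ (Fin (n + 2)), x (Fin.last (n + 1)) = 0 → ψ x = 0) :
    ∫ y in {y | 0 < y (Fin.last (n + 1))}, u y * lapl ψ y = 0 := by
  set L := Fin.last (n + 1) with hL
  set H : Set (EuclideanSpace ℝ (Fin (n + 2))) := {y | 0 < y L} with hH
  have hHo : IsOpen H := isOpen_setOf_pos_apply L
  obtain ⟨C, hC⟩ := ContDiff.lipschitzWith_of_hasCompactSupport hc hψ (by norm_num)
  have hlc : HasCompactSupport (lapl ψ) :=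
    hc.of_isClosed_subset (isClosed_tsupport _) (tsupport_lapl_subset ψ)
  obtain ⟨M, hM⟩ := hlc.exists_bound_of_continuous (continuous_lapl hψ)
  obtain ⟨M', hM'⟩ := (hc.fderiv_apply (𝕜 := ℝ) (EuclideanSpace.single L 1)).exists_bound_of_continuous
    (contDiff_fderiv_apply hψ _).continuous
  have hM0 : 0 ≤ M := (norm_nonneg _).trans (hM 0)
  have hM'0 : 0 ≤ M' := (norm_nonneg _).trans (hM' 0)
  obtain ⟨A, hA0, hA⟩ := exists_cutoff
  obtain ⟨R, hR0, hR⟩ : ∃ R : ℝ, 0 ≤ R ∧ ∀ y, R < ‖y‖ → y ∉ tsupport ψ := by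
    obtain ⟨R, hR⟩ := hc.isCompact.isBounded.exists_norm_le
    exact ⟨max R 0, le_max_right _ _, fun y hy hy' =>
      absurd (hR y hy') (not_le.2 ((le_max_left _ _).trans_lt hy))⟩
  set K : ℝ := M + 2 * A * M' + 2 * A * C with hKdef
  have hK0 : 0 ≤ K := by positivity
  have main (δ : ℝ) (hδ : 0 < δ) :
      |∫ y in H, u y * lapl ψ y| ≤ δ * (K * (2 * (2 * R) ^ (n + 1))) := by
    obtain ⟨ε₀, hε₀, hu⟩ := exists_small_near_boundary hcont hbd R hδ
    set ε := min ε₀ 1 with hε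
    have hεpos : 0 < ε := lt_min hε₀ one_pos
    have hε1 : ε ≤ 1 := min_le_right _ _
    have hεε₀ : ε ≤ ε₀ := min_le_left _ _
    obtain ⟨h, hh, hh0, hh1, hh01, hd1, hd2⟩ := hA ε hεpos
    set φ : EuclideanSpace ℝ (Fin (n + 2)) → ℝ := fun y => h (y L) * ψ y with hφ
    have hφs : tsupport φ ⊆ tsupport ψ := tsupport_mul_subset_right
    have hφc : HasCompactSupport φ := hc.of_isClosed_subset (isClosed_tsupport _) hφs
    have hφH : tsupport φ ⊆ H := by
      have hcl : IsClosed {y : EuclideanSpace ℝ (Fin (n + 2)) | ε ≤ y L} :=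
        isClosed_le continuous_const (by fun_prop)
      refine (closure_minimal (fun y hy => ?_) hcl).trans
        (fun y (hy : ε ≤ y L) => hεpos.trans_le hy)
      by_contra hlt
      exact hy (by simp [hφ, hh0 _ (not_le.1 hlt).le])
    have hφ2 : ContDiff ℝ 2 φ :=
      (hh.comp (EuclideanSpace.proj (𝕜 := ℝ) L :
        EuclideanSpace ℝ (Fin (n + 2)) →L[ℝ] ℝ).contDiff).mul hψ
    have hφlc : HasCompactSupport (lapl φ) :=
      hφc.of_isClosed_subset (isClosed_tsupport _) (tsupport_lapl_subset φ)
    have hzero : ∫ y in H, u y * lapl φ y = 0 := by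
      rw [setIntegral_eq_integral_of_forall_compl_eq_zero]
      · exact hharm.integral_mul_lapl_eq_zero hHo hφ2 hφc hφH
      · intro y hy
        have : y ∉ tsupport (lapl φ) := fun h' => hy (hφH (tsupport_lapl_subset φ h'))
        simp [image_eq_zero_of_notMem_tsupport this]
    set S : Set (EuclideanSpace ℝ (Fin (n + 2))) := {y | 0 ≤ y L ∧ y L ≤ 2 * ε ∧ ‖y‖ ≤ R} with hS
    have hSc : IsCompact S := by
      have : S = Metric.closedBall 0 R ∩ ({y | 0 ≤ y L} ∩ {y | y L ≤ 2 * ε}) := by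
        ext y
        simp only [hS, mem_ofPred_eq, mem_inter_iff, mem_closedBall_zero_iff]
        tauto
      rw [this]
      exact (isCompact_closedBall _ _).inter_right ((isClosed_le continuous_const
        (by fun_prop)).inter (isClosed_le (by fun_prop) continuous_const))
    have hdiff : ∀ y ∈ H, y ∉ S → u y * lapl ψ y - u y * lapl φ y = 0 := by
      intro y hy hyS
      have hy0 : 0 < y L := hy
      by_cases hyR : ‖y‖ ≤ R
      · have hy2 : 2 * ε < y L := by
          by_contra hlt
          exact hyS ⟨hy0.le, not_lt.1 hlt, hyR⟩
        have hev : h =ᶠ[𝓝 (y L)] fun _ => 1 := by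
          filter_upwards [Ioi_mem_nhds hy2] with s hs using hh1 s (mem_Ioi.1 hs).le
        have hd : deriv h =ᶠ[𝓝 (y L)] fun _ => 0 := by
          filter_upwards [hev.deriv] with s hs
          simpa using hs
        rw [hφ, lapl_comp_apply_mul L hh hψ, hd.deriv_eq, hd.eq_of_nhds, hh1 _ hy2.le]
        simp
      · have h1 := hR y (not_le.1 hyR)
        rw [image_eq_zero_of_notMem_tsupport fun h' => h1 (tsupport_lapl_subset ψ h'),
          image_eq_zero_of_notMem_tsupport fun h' => h1 (hφs (tsupport_lapl_subset φ h'))]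
        simp
    have hbound : ∀ y ∈ H ∩ S, ‖u y * lapl ψ y - u y * lapl φ y‖ ≤ δ * (K / ε) := by
      rintro y ⟨-, hy0, hy2, hyR⟩
      have hψy : |ψ y| ≤ C * (2 * ε) := (abs_le_mul_of_lipschitzWith hC hψ0 y).trans
        (by rw [abs_of_nonneg hy0]; gcongr)
      rw [← mul_sub, norm_mul, Real.norm_eq_abs, Real.norm_eq_abs]
      refine mul_le_mul (hu y hy0 (by linarith) hyR) ?_ (abs_nonneg _) hδ.le
      rw [hφ, lapl_comp_apply_mul L hh hψ]
      have e : lapl ψ y - (h (y L) * lapl ψ y +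
          2 * deriv h (y L) * fderiv ℝ ψ y (EuclideanSpace.single L 1) +
          deriv (deriv h) (y L) * ψ y) = (1 - h (y L)) * lapl ψ y -
          2 * (deriv h (y L) * fderiv ℝ ψ y (EuclideanSpace.single L 1)) -
          deriv (deriv h) (y L) * ψ y := by ring
      have b1 : |(1 - h (y L)) * lapl ψ y| ≤ M / ε := by
        rw [abs_mul]
        have h1 : |1 - h (y L)| ≤ 1 := by
          rw [abs_le]; constructor <;> linarith [(hh01 (y L)).1, (hh01 (y L)).2]
        have h2 : M ≤ M / ε := le_div_self hM0 hεpos hε1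
        have h3 : |lapl ψ y| ≤ M := hM y
        nlinarith [abs_nonneg (lapl ψ y), abs_nonneg (1 - h (y L))]
      have b2 : |deriv h (y L) * fderiv ℝ ψ y (EuclideanSpace.single L 1)| ≤ A / ε * M' := by
        rw [abs_mul]
        exact mul_le_mul (hd1 _) (hM' y) (abs_nonneg _) (by positivity)
      have b3 : |deriv (deriv h) (y L) * ψ y| ≤ A / ε ^ 2 * (C * (2 * ε)) := by
        rw [abs_mul]
        exact mul_le_mul (hd2 _) hψy (abs_nonneg _) (by positivity)
      have e2 : K / ε = M / ε + 2 * (A / ε * M') + A / ε ^ 2 * (C * (2 * ε)) := by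
        rw [hKdef]; field_simp
      rw [e, e2, abs_le]
      rw [abs_le] at b1 b2 b3
      constructor <;> linarith [b1.1, b1.2, b2.1, b2.2, b3.1, b3.2]
    have hvol := volume_slab_le (m := n + 1) L (a := 0) (b := 2 * ε) (R := R) (by positivity) hR0
    rw [sub_zero] at hvol
    calc |∫ y in H, u y * lapl ψ y|
        = |∫ y in H, (u y * lapl ψ y - u y * lapl φ y)| := by
          rw [integral_sub (integrableOn_mul_of_hasCompactSupport hcont (continuous_lapl hψ) hlc)
            (integrableOn_mul_of_hasCompactSupport hcont (continuous_lapl hφ2) hφlc), hzero,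
            sub_zero]
      _ = |∫ y in H ∩ S, (u y * lapl ψ y - u y * lapl φ y)| := by
          rw [setIntegral_eq_of_subset_of_forall_sdiff_eq_zero hHo.measurableSet inter_subset_left]
          exact fun y hy => hdiff y hy.1 fun h' => hy.2 ⟨hy.1, h'⟩
      _ ≤ δ * (K / ε) * volume.real (H ∩ S) :=
          norm_setIntegral_le_of_norm_le_const
            ((measure_mono inter_subset_right).trans_lt hSc.measure_lt_top) hbound
      _ ≤ δ * (K / ε) * (2 * ε * (2 * R) ^ (n + 1)) := by
          gcongr
          exact (measureReal_mono inter_subset_right hSc.measure_lt_top.ne).trans hvol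
      _ = _ := by field_simp
  set B := K * (2 * (2 * R) ^ (n + 1)) with hB
  have hB0 : 0 ≤ B := by positivity
  refine abs_nonpos_iff.1 (le_of_forall_pos_le_add fun η hη => ?_)
  have h1 := main (η / (B + 1)) (by positivity)
  have h2 : η / (B + 1) * B ≤ η := by
    rw [div_mul_eq_mul_div, div_le_iff₀ (by positivity)]
    nlinarith
  linarith

/-- The kernel `(r² - |y - a|²)₊ᵏ`. -/
def bump {m : ℕ} (k : ℕ) (a : EuclideanSpace ℝ (Fin m)) (r : ℝ) (y : EuclideanSpace ℝ (Fin m)) : ℝ :=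
  max (r ^ 2 - ‖y - a‖ ^ 2) 0 ^ k

section Bump

variable {m : ℕ} (k : ℕ) (a : EuclideanSpace ℝ (Fin m)) (r : ℝ)

theorem bump_nonneg (y : EuclideanSpace ℝ (Fin m)) : 0 ≤ bump k a r y :=
  pow_nonneg (le_max_right _ _) _

theorem bump_eq_zero {k : ℕ} (hk : k ≠ 0) {a y : EuclideanSpace ℝ (Fin m)} {r : ℝ}
    (h : |r| ≤ ‖y - a‖) : bump k a r y = 0 := by
  have : r ^ 2 ≤ ‖y - a‖ ^ 2 := sq_le_sq.2 (by rwa [abs_norm])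
  rw [bump, max_eq_right (by linarith), zero_pow hk]

theorem continuous_bump : Continuous (bump k a r) := by
  unfold bump
  fun_prop

theorem hasCompactSupport_bump {k : ℕ} (hk : k ≠ 0) : HasCompactSupport (bump k a r) := by
  refine HasCompactSupport.of_support_subset_isCompact (isCompact_closedBall a |r|) fun y hy => ?_
  by_contra h
  rw [mem_closedBall_iff_norm, not_le] at h
  exact hy (bump_eq_zero hk h.le)

theorem contDiff_bump_four : ContDiff ℝ 2 (bump 4 a r) :=
  contDiff_max_zero_pow_four.comp
    (contDiff_const.sub ((contDiff_id.sub contDiff_const).norm_sq ℝ))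

theorem hasFDerivAt_bump {k : ℕ} (hk : k ≠ 0) (y : EuclideanSpace ℝ (Fin m)) :
    HasFDerivAt (bump (k + 1) a r)
      (((k + 1) * bump k a r y) • (-(2 : ℝ) • innerSL ℝ (y - a))) y := by
  have h1 : HasFDerivAt (fun y => r ^ 2 - ‖y - a‖ ^ 2) (-(2 : ℝ) • innerSL ℝ (y - a)) y := by
    have := ((hasFDerivAt_id y).sub_const a).norm_sq.const_sub (r ^ 2)
    refine this.congr_fderiv ?_
    ext v
    simp
  exact (hasDerivAt_max_zero_pow hk _).comp_hasFDerivAt y h1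

theorem fderiv_bump_single {k : ℕ} (hk : k ≠ 0) (y : EuclideanSpace ℝ (Fin m)) (i : Fin m) :
    fderiv ℝ (bump (k + 1) a r) y (EuclideanSpace.single i 1) =
      -2 * (k + 1) * bump k a r y * (y i - a i) := by
  rw [(hasFDerivAt_bump a r hk y).fderiv]
  simp [EuclideanSpace.inner_single_right]
  ring

theorem lapl_bump_four (y : EuclideanSpace ℝ (Fin m)) :
    lapl (bump 4 a r) y = 48 * r ^ 2 * bump 2 a r y - (48 + 8 * m) * bump 3 a r y := by
  have h1 (i : Fin m) : (fun y => fderiv ℝ (bump 4 a r) y (EuclideanSpace.single i 1)) =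
      fun y => -8 * (bump 3 a r y * (y i - a i)) := by
    ext y
    rw [fderiv_bump_single a r (k := 3) (by norm_num)]
    push_cast
    ring
  have h2 (i : Fin m) : fderiv ℝ (fun y => fderiv ℝ (bump 4 a r) y (EuclideanSpace.single i 1)) y
      (EuclideanSpace.single i 1) = 48 * bump 2 a r y * (y i - a i) ^ 2 - 8 * bump 3 a r y := by
    have hp : HasFDerivAt (fun y : EuclideanSpace ℝ (Fin m) => y i)
        (EuclideanSpace.proj (𝕜 := ℝ) i : EuclideanSpace ℝ (Fin m) →L[ℝ] ℝ) y :=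
      (EuclideanSpace.proj (𝕜 := ℝ) i : EuclideanSpace ℝ (Fin m) →L[ℝ] ℝ).hasFDerivAt
    rw [h1, (((hasFDerivAt_bump a r (k := 2) (by norm_num) y).fun_mul
      (hp.sub_const (a i))).const_mul (-8)).fderiv]
    simp [EuclideanSpace.inner_single_right]
    ring
  have h3 : ∑ i, (y i - a i) ^ 2 = ‖y - a‖ ^ 2 := by
    simp [EuclideanSpace.norm_sq_eq]
  have h4 : bump 2 a r y * ‖y - a‖ ^ 2 = r ^ 2 * bump 2 a r y - bump 3 a r y := by
    unfold bump
    rcases le_total (r ^ 2 - ‖y - a‖ ^ 2) 0 with h | h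
    · simp [max_eq_right h]
    · rw [max_eq_left h]; ring
  simp only [lapl, h2, Finset.sum_sub_distrib, ← Finset.mul_sum, h3, Finset.sum_const,
    Finset.card_univ, Fintype.card_fin, nsmul_eq_mul]
  linear_combination 48 * h4

theorem hasDerivAt_bump {k : ℕ} (hk : k ≠ 0) (y : EuclideanSpace ℝ (Fin m)) :
    HasDerivAt (fun r => bump (k + 1) a r y) (2 * (k + 1) * r * bump k a r y) r := by
  have h1 : HasDerivAt (fun r : ℝ => r ^ 2 - ‖y - a‖ ^ 2) (2 * r) r := by
    simpa using (hasDerivAt_pow 2 r).sub_const (‖y - a‖ ^ 2)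
  refine ((hasDerivAt_max_zero_pow hk _).comp r h1).congr_deriv ?_
  rw [bump]
  ring

theorem bump_mono {k : ℕ} {r s : ℝ} (hrs : |r| ≤ |s|) (y : EuclideanSpace ℝ (Fin m)) :
    bump k a r y ≤ bump k a s y := by
  have := sq_le_sq.2 hrs
  unfold bump
  gcongr

theorem integral_bump {r : ℝ} (hr : 0 < r) :
    ∫ y, bump k a r y = r ^ (m + 2 * k) * ∫ y, bump k (0 : EuclideanSpace ℝ (Fin m)) 1 y := by
  have h1 : ∫ y, bump k a r y = ∫ y, bump k (0 : EuclideanSpace ℝ (Fin m)) r y := by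
    rw [← integral_sub_right_eq_self (bump k (0 : EuclideanSpace ℝ (Fin m)) r) a]
    simp [bump]
  have h2 (y : EuclideanSpace ℝ (Fin m)) :
      bump k 0 r y = r ^ (2 * k) * bump k 0 1 (r⁻¹ • y) := by
    rw [bump, bump, pow_mul, ← mul_pow, mul_max_of_nonneg _ _ (sq_nonneg r)]
    simp only [sub_zero, norm_smul, mul_zero, norm_inv, Real.norm_eq_abs, abs_of_pos hr]
    congr 2
    field_simp
  simp only [h1, h2, integral_const_mul]
  rw [Measure.integral_comp_smul, finrank_euclideanSpace_fin, inv_pow, inv_inv,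
    abs_of_pos (by positivity), smul_eq_mul]
  ring

theorem integral_bump_pos {k : ℕ} (hk : k ≠ 0) :
    0 < ∫ y, bump k (0 : EuclideanSpace ℝ (Fin m)) 1 y :=
  (continuous_bump k 0 1).integral_pos_of_hasCompactSupport_nonneg_nonzero
    (hasCompactSupport_bump 0 1 hk) (bump_nonneg k 0 1) (x := 0) (by simp [bump])

end Bump

/-- Reflection in the boundary hyperplane. -/
def reflect {n : ℕ} (x : EuclideanSpace ℝ (Fin (n + 2))) : EuclideanSpace ℝ (Fin (n + 2)) :=
  x - (2 * x (Fin.last (n + 1))) • en n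

theorem norm_sub_reflect_sq {n : ℕ} (x y : EuclideanSpace ℝ (Fin (n + 2))) :
    ‖y - reflect x‖ ^ 2 =
      ‖y - x‖ ^ 2 + 4 * x (Fin.last (n + 1)) * y (Fin.last (n + 1)) := by
  have : y - reflect x = (y - x) + (2 * x (Fin.last (n + 1))) • en n := by
    rw [reflect]; abel
  rw [this, norm_add_sq_real, norm_smul_en, sq_abs, inner_smul_right, en,
    EuclideanSpace.inner_single_right]
  simp
  ring

theorem norm_reflect {n : ℕ} (x : EuclideanSpace ℝ (Fin (n + 2))) : ‖reflect x‖ = ‖x‖ := by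
  have := norm_sub_reflect_sq x 0
  simp only [zero_sub, norm_neg, PiLp.zero_apply, mul_zero, add_zero] at this
  exact (sq_eq_sq₀ (norm_nonneg _) (norm_nonneg _)).1 this

/-- The kernel `bump` made odd with respect to the boundary hyperplane. -/
def oddBump {n : ℕ} (k : ℕ) (x : EuclideanSpace ℝ (Fin (n + 2))) (r : ℝ)
    (y : EuclideanSpace ℝ (Fin (n + 2))) : ℝ :=
  bump k x r y - bump k (reflect x) r y

section OddBump

variable {n : ℕ} (k : ℕ) (x : EuclideanSpace ℝ (Fin (n + 2))) (r : ℝ)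

theorem continuous_oddBump : Continuous (oddBump k x r) :=
  (continuous_bump k x r).sub (continuous_bump k (reflect x) r)

theorem hasCompactSupport_oddBump {k : ℕ} (hk : k ≠ 0) : HasCompactSupport (oddBump k x r) :=
  (hasCompactSupport_bump x r hk).sub (hasCompactSupport_bump (reflect x) r hk)

theorem oddBump_eq_zero {y : EuclideanSpace ℝ (Fin (n + 2))} (hy : y (Fin.last (n + 1)) = 0) :
    oddBump k x r y = 0 := by
  simp [oddBump, bump, norm_sub_reflect_sq, hy]

theorem lapl_oddBump_four (y : EuclideanSpace ℝ (Fin (n + 2))) :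
    lapl (oddBump 4 x r) y =
      48 * r ^ 2 * oddBump 2 x r y - 8 * (n + 8) * oddBump 3 x r y := by
  have h (a : EuclideanSpace ℝ (Fin (n + 2))) (y i) : DifferentiableAt ℝ
      (fun y => fderiv ℝ (bump 4 a r) y (EuclideanSpace.single i 1)) y :=
    (contDiff_fderiv_apply (contDiff_bump_four a r) _).differentiable (by norm_num) y
  have h' (a y : EuclideanSpace ℝ (Fin (n + 2))) : DifferentiableAt ℝ (bump 4 a r) y :=
    (contDiff_bump_four a r).differentiable (by norm_num) y
  have h1 (i) : (fun y => fderiv ℝ (oddBump 4 x r) y (EuclideanSpace.single i 1)) = fun y =>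
      fderiv ℝ (bump 4 x r) y (EuclideanSpace.single i 1) -
      fderiv ℝ (bump 4 (reflect x) r) y (EuclideanSpace.single i 1) := by
    ext y
    rw [show oddBump 4 x r = fun y => bump 4 x r y - bump 4 (reflect x) r y from rfl,
      fderiv_fun_sub (h' _ _) (h' _ _)]
    rfl
  have h2 : lapl (oddBump 4 x r) y = lapl (bump 4 x r) y - lapl (bump 4 (reflect x) r) y := by
    simp only [lapl, h1, fderiv_fun_sub (h _ _ _) (h _ _ _), ← Finset.sum_sub_distrib]
    rfl
  rw [h2, lapl_bump_four, lapl_bump_four, oddBump, oddBump]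
  push_cast
  ring

theorem hasDerivAt_oddBump {k : ℕ} (hk : k ≠ 0) (y : EuclideanSpace ℝ (Fin (n + 2))) :
    HasDerivAt (fun r => oddBump (k + 1) x r y) (2 * (k + 1) * r * oddBump k x r y) r :=
  ((hasDerivAt_bump x r hk y).sub (hasDerivAt_bump (reflect x) r hk y)).congr_deriv
    (by rw [oddBump]; ring)

theorem abs_oddBump_le {r s : ℝ} (hrs : |r| ≤ |s|) (y : EuclideanSpace ℝ (Fin (n + 2))) :
    |oddBump k x r y| ≤ bump k x s y + bump k (reflect x) s y := by
  have h1 := bump_mono x (k := k) hrs y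
  have h2 := bump_mono (reflect x) (k := k) hrs y
  have h3 := bump_nonneg k x r y
  have h4 := bump_nonneg k (reflect x) r y
  rw [oddBump, abs_le]
  constructor <;> linarith

end OddBump

section Moment

variable {n : ℕ} {u : EuclideanSpace ℝ (Fin (n + 2)) → ℝ}

theorem hasDerivAt_setIntegral_oddBump
    (hcont : ContinuousOn u {x | 0 ≤ x (Fin.last (n + 1))})
    (x : EuclideanSpace ℝ (Fin (n + 2))) (r : ℝ) :
    HasDerivAt (fun r => ∫ y in {y | 0 < y (Fin.last (n + 1))}, u y * oddBump 3 x r y)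
      (6 * r * ∫ y in {y | 0 < y (Fin.last (n + 1))}, u y * oddBump 2 x r y) r := by
  set s : ℝ := |r| + 1 with hs
  have hs0 : 0 < s := by positivity
  have hmeas (k : ℕ) (hk : k ≠ 0) (r : ℝ) :=
    (integrableOn_mul_of_hasCompactSupport hcont (continuous_oddBump k x r)
      (hasCompactSupport_oddBump x r hk))
  have hb (a : EuclideanSpace ℝ (Fin (n + 2))) :=
    integrableOn_mul_of_hasCompactSupport hcont (continuous_bump 2 a s)
      (hasCompactSupport_bump a s (k := 2) (by norm_num))
  have key := (hasDerivAt_integral_of_dominated_loc_of_deriv_le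
    (μ := volume.restrict {y : EuclideanSpace ℝ (Fin (n + 2)) | 0 < y (Fin.last (n + 1))})
    (F := fun r y => u y * oddBump 3 x r y)
    (F' := fun r y => u y * (6 * r * oddBump 2 x r y))
    (bound := fun y => 6 * s * (|u y * bump 2 x s y| + |u y * bump 2 (reflect x) s y|))
    (x₀ := r) (s := Metric.ball r 1) (Metric.ball_mem_nhds r one_pos)
    (Eventually.of_forall fun r => (hmeas 3 (by norm_num) r).aestronglyMeasurable)
    (hmeas 3 (by norm_num) r)
    ?_ ?_ ?_ ?_).2
  · refine key.congr_deriv ?_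
    rw [← integral_const_mul]
    congr 1 with y
    ring
  · have := ((hmeas 2 (by norm_num) r).const_mul (6 * r)).aestronglyMeasurable
    refine this.congr (Eventually.of_forall fun y => ?_)
    simp only
    ring
  · refine Eventually.of_forall fun y t ht => ?_
    have hts : |t| ≤ s := by
      rw [Metric.mem_ball, Real.dist_eq] at ht
      have := abs_sub_abs_le_abs_sub t r
      linarith
    have h1 := abs_oddBump_le 2 x (hts.trans (le_abs_self s)) y
    rw [Real.norm_eq_abs, abs_mul, abs_mul, abs_mul, abs_mul, abs_mul,
      abs_of_nonneg (bump_nonneg 2 x s y), abs_of_nonneg (bump_nonneg 2 (reflect x) s y),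
      ← mul_add, abs_of_nonneg (by norm_num : (0 : ℝ) ≤ 6)]
    calc |u y| * (6 * |t| * |oddBump 2 x t y|)
        ≤ |u y| * (6 * s * (bump 2 x s y + bump 2 (reflect x) s y)) := by gcongr
      _ = _ := by ring
  · exact ((hb x).abs.add (hb (reflect x)).abs).const_mul _
  · refine Eventually.of_forall fun y t _ => ?_
    have := (hasDerivAt_oddBump x t (k := 2) (by norm_num) y).const_mul (u y)
    refine this.congr_deriv ?_
    push_cast
    ring

theorem setIntegral_oddBump_recurrence
    (hcont : ContinuousOn u {x | 0 ≤ x (Fin.last (n + 1))})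
    (hharm : IsHarmonicOn u {x | 0 < x (Fin.last (n + 1))})
    (hbd : ∀ x : EuclideanSpace ℝ (Fin (n + 2)), x (Fin.last (n + 1)) = 0 → u x = 0)
    (x : EuclideanSpace ℝ (Fin (n + 2))) (r : ℝ) :
    6 * r ^ 2 * ∫ y in {y | 0 < y (Fin.last (n + 1))}, u y * oddBump 2 x r y =
      (n + 8) * ∫ y in {y | 0 < y (Fin.last (n + 1))}, u y * oddBump 3 x r y := by
  have h := setIntegral_mul_lapl_eq_zero hcont hharm hbd
    ((contDiff_bump_four x r).sub (contDiff_bump_four (reflect x) r))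
    (hasCompactSupport_oddBump x r (k := 4) (by norm_num)) fun y hy => oddBump_eq_zero 4 x r hy
  have hi (k : ℕ) (hk : k ≠ 0) :=
    (integrableOn_mul_of_hasCompactSupport hcont (continuous_oddBump k x r)
      (hasCompactSupport_oddBump x r hk))
  have e (y) : u y * lapl (oddBump 4 x r) y = 48 * r ^ 2 * (u y * oddBump 2 x r y) -
      8 * (n + 8) * (u y * oddBump 3 x r y) := by
    rw [lapl_oddBump_four]; ring
  have h' : ∫ y in {y | 0 < y (Fin.last (n + 1))}, u y * lapl (oddBump 4 x r) y = 0 := h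
  simp only [e] at h'
  rw [integral_sub ((hi 2 (by norm_num)).const_mul _) ((hi 3 (by norm_num)).const_mul _),
    integral_const_mul, integral_const_mul] at h'
  linarith

theorem setIntegral_oddBump_homogeneous
    (hcont : ContinuousOn u {x | 0 ≤ x (Fin.last (n + 1))})
    (hharm : IsHarmonicOn u {x | 0 < x (Fin.last (n + 1))})
    (hbd : ∀ x : EuclideanSpace ℝ (Fin (n + 2)), x (Fin.last (n + 1)) = 0 → u x = 0)
    (x : EuclideanSpace ℝ (Fin (n + 2))) {r s : ℝ} (hr : 0 < r) (hs : 0 < s) :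
    (∫ y in {y | 0 < y (Fin.last (n + 1))}, u y * oddBump 3 x r y) / r ^ (n + 8) =
      (∫ y in {y | 0 < y (Fin.last (n + 1))}, u y * oddBump 3 x s y) / s ^ (n + 8) := by
  have hd (t : ℝ) (ht : 0 < t) : HasDerivAt
      (fun r => (∫ y in {y | 0 < y (Fin.last (n + 1))}, u y * oddBump 3 x r y) / r ^ (n + 8))
      0 t := by
    refine ((hasDerivAt_setIntegral_oddBump hcont x t).div (hasDerivAt_pow (n + 8) t)
      (by positivity)).congr_deriv ?_
    have h := setIntegral_oddBump_recurrence hcont hharm hbd x t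
    rw [div_eq_zero_iff]
    left
    rw [show n + 8 - 1 = n + 7 by omega, pow_succ t (n + 7)]
    push_cast
    linear_combination t ^ (n + 7) * h
  exact isOpen_Ioi.is_const_of_deriv_eq_zero isPreconnected_Ioi
    (fun t ht => (hd t ht).differentiableAt.differentiableWithinAt)
    (fun t ht => (hd t ht).deriv) (mem_Ioi.2 hr) (mem_Ioi.2 hs)

/-- Mean value formula over balls that may cross the boundary hyperplane. -/
theorem setIntegral_oddBump_eq
    (hcont : ContinuousOn u {x | 0 ≤ x (Fin.last (n + 1))})
    (hharm : IsHarmonicOn u {x | 0 < x (Fin.last (n + 1))})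
    (hbd : ∀ x : EuclideanSpace ℝ (Fin (n + 2)), x (Fin.last (n + 1)) = 0 → u x = 0)
    {x : EuclideanSpace ℝ (Fin (n + 2))} (hx : 0 < x (Fin.last (n + 1))) {r : ℝ} (hr : 0 < r) :
    ∫ y in {y | 0 < y (Fin.last (n + 1))}, u y * oddBump 3 x r y =
      (∫ y, bump 3 (0 : EuclideanSpace ℝ (Fin (n + 2))) 1 y) * u x * r ^ (n + 8) := by
  set H : Set (EuclideanSpace ℝ (Fin (n + 2))) := {y | 0 < y (Fin.last (n + 1))} with hH
  set c := ∫ y, bump 3 (0 : EuclideanSpace ℝ (Fin (n + 2))) 1 y with hc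
  have hc0 : 0 < c := integral_bump_pos (by norm_num)
  have hHo : IsOpen H := isOpen_setOf_pos_apply _
  suffices h : (∫ y in H, u y * oddBump 3 x r y) / r ^ (n + 8) = c * u x by
    rwa [div_eq_iff (by positivity)] at h
  have main (δ : ℝ) (hδ : 0 < δ) :
      |(∫ y in H, u y * oddBump 3 x r y) / r ^ (n + 8) - c * u x| ≤ δ * c := by
    have hcx : ContinuousAt u x := hharm.1.continuousOn.continuousAt (hHo.mem_nhds hx)
    obtain ⟨η, hη, hu⟩ := Metric.continuousAt_iff.1 hcx δ hδ
    set t := min η (x (Fin.last (n + 1))) with ht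
    have ht0 : 0 < t := lt_min hη hx
    have hcoord (z : EuclideanSpace ℝ (Fin (n + 2))) : |z (Fin.last (n + 1))| ≤ ‖z‖ :=
      PiLp.norm_apply_le z _
    have h1 : ∀ y ∈ H, bump 3 (reflect x) t y = 0 := by
      intro y (hy : 0 < y (Fin.last (n + 1)))
      refine bump_eq_zero (by norm_num) ?_
      have := (le_abs_self _).trans (hcoord (y - reflect x))
      simp only [reflect, PiLp.sub_apply, PiLp.smul_apply, en_last, smul_eq_mul] at this
      rw [abs_of_pos ht0]
      have h3 : t ≤ x (Fin.last (n + 1)) := min_le_right _ _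
      unfold reflect
      linarith
    have h2 : ∀ y ∉ H, bump 3 x t y = 0 := by
      intro y hy
      have hy' : y (Fin.last (n + 1)) ≤ 0 := not_lt.1 hy
      refine bump_eq_zero (by norm_num) ?_
      have := (neg_le_abs _).trans (hcoord (y - x))
      rw [PiLp.sub_apply] at this
      rw [abs_of_pos ht0]
      have h3 : t ≤ x (Fin.last (n + 1)) := min_le_right _ _
      linarith
    have h3 : ∫ y in H, bump 3 x t y = c * t ^ (n + 8) := by
      rw [setIntegral_eq_integral_of_forall_compl_eq_zero h2, integral_bump 3 x ht0, mul_comm]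
    have hib := (continuous_bump 3 x t).integrable_of_hasCompactSupport (μ := volume)
      (hasCompactSupport_bump x t (by norm_num))
    have h4 : ∫ y in H, u y * oddBump 3 x t y = ∫ y in H, u y * bump 3 x t y :=
      setIntegral_congr_fun hHo.measurableSet fun y hy => by simp [oddBump, h1 y hy]
    have h5 : |∫ y in H, (u y * bump 3 x t y - u x * bump 3 x t y)| ≤
        ∫ y in H, δ * bump 3 x t y := by
      rw [← Real.norm_eq_abs]
      refine norm_integral_le_of_norm_le (hib.integrableOn.const_mul δ)
        (Eventually.of_forall fun y => ?_)
      rw [← sub_mul, norm_mul, Real.norm_eq_abs, Real.norm_eq_abs,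
        abs_of_nonneg (bump_nonneg 3 x t y)]
      by_cases hy : dist y x < η
      · have h6 := hu hy
        rw [Real.dist_eq] at h6
        exact mul_le_mul_of_nonneg_right h6.le (bump_nonneg 3 x t y)
      · rw [bump_eq_zero (by norm_num), mul_zero, mul_zero]
        rw [abs_of_pos ht0, ← dist_eq_norm]
        exact (min_le_left _ _).trans (not_lt.1 hy)
    rw [integral_sub (integrableOn_mul_of_hasCompactSupport hcont (continuous_bump 3 x t)
      (hasCompactSupport_bump x t (by norm_num))) (hib.integrableOn.const_mul _),
      integral_const_mul, integral_const_mul, h3, ← h4] at h5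
    rw [setIntegral_oddBump_homogeneous hcont hharm hbd x hr ht0]
    have ht8 : 0 < t ^ (n + 8) := by positivity
    rw [div_sub' ht8.ne', abs_div, abs_of_pos ht8, div_le_iff₀ ht8]
    rw [show t ^ (n + 8) * (c * u x) = u x * (c * t ^ (n + 8)) by ring, mul_assoc δ]
    exact h5
  refine sub_eq_zero.1 (abs_nonpos_iff.1 (le_of_forall_pos_le_add fun η hη => ?_))
  have := main (η / c) (by positivity)
  rw [div_mul_cancel₀ _ hc0.ne'] at this
  linarith

end Moment

theorem max_zero_cube_sub_le {p q : ℝ} (h : q ≤ p) :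
    max p 0 ^ 3 - max q 0 ^ 3 ≤ 3 * (p - q) * max p 0 ^ 2 := by
  have hP : 0 ≤ max p 0 := le_max_right _ _
  have hQ : 0 ≤ max q 0 := le_max_right _ _
  have hPQ : max q 0 ≤ max p 0 := max_le_max_right 0 h
  have hd : max p 0 - max q 0 ≤ p - q := by
    rcases le_total p 0 with h1 | h1
    · rw [max_eq_right h1, max_eq_right (h.trans h1)]; linarith
    · rw [max_eq_left h1]; linarith [le_max_left q 0]
  calc max p 0 ^ 3 - max q 0 ^ 3
      = (max p 0 - max q 0) * (max p 0 ^ 2 + max p 0 * max q 0 + max q 0 ^ 2) := by ring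
    _ ≤ (p - q) * (max p 0 ^ 2 + max p 0 * max p 0 + max p 0 ^ 2) := by gcongr
    _ = _ := by ring

theorem le_max_zero_cube_sub {p q : ℝ} (h : q ≤ p) :
    3 * (p - q) * max q 0 ^ 2 ≤ max p 0 ^ 3 - max q 0 ^ 3 := by
  rcases le_total q 0 with hq | hq
  · rw [max_eq_right hq]
    have : 0 ≤ max p 0 := le_max_right _ _
    simp only [ne_eq, OfNat.ofNat_ne_zero, not_false_eq_true, zero_pow, mul_zero, sub_zero]
    positivity
  · rw [max_eq_left hq, max_eq_left (hq.trans h)]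
    have : 0 ≤ (p - q) ^ 2 * (p + 2 * q) := mul_nonneg (sq_nonneg _) (by linarith)
    nlinarith

theorem abs_max_zero_sq_sub_le {p q s : ℝ} (hp : p ≤ s) (hq : q ≤ s) (hs : 0 ≤ s) :
    |max p 0 ^ 2 - max q 0 ^ 2| ≤ |p - q| * (2 * s) := by
  have hP : 0 ≤ max p 0 := le_max_right _ _
  have hQ : 0 ≤ max q 0 := le_max_right _ _
  rw [sq_sub_sq, abs_mul, mul_comm, abs_of_nonneg (add_nonneg hP hQ)]
  exact mul_le_mul (abs_max_sub_max_le_abs p q 0)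
    (by linarith [max_le hp hs, max_le hq hs]) (by positivity) (abs_nonneg _)

theorem abs_norm_sub_sq_sub_le {m : ℕ} {a y : EuclideanSpace ℝ (Fin m)} {r : ℝ} (ha : ‖a‖ ≤ r)
    (hy : ‖y‖ ≤ 2 * r) : |r ^ 2 - ‖y - a‖ ^ 2 - (r ^ 2 - ‖y‖ ^ 2)| ≤ 5 * ‖a‖ * r := by
  have h1 := abs_norm_sub_norm_le y (y - a)
  have h2 := norm_sub_le y a
  rw [sub_sub_cancel] at h1
  rw [show r ^ 2 - ‖y - a‖ ^ 2 - (r ^ 2 - ‖y‖ ^ 2) =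
    (‖y‖ - ‖y - a‖) * (‖y‖ + ‖y - a‖) by ring, abs_mul,
    abs_of_nonneg (by positivity : 0 ≤ ‖y‖ + ‖y - a‖)]
  calc |‖y‖ - ‖y - a‖| * (‖y‖ + ‖y - a‖) ≤ ‖a‖ * (5 * r) := by gcongr; linarith
    _ = _ := by ring

section Asymptotics

variable {n : ℕ} {x y : EuclideanSpace ℝ (Fin (n + 2))} {r : ℝ}

theorem abs_oddBump_sub_le (hx : 0 ≤ x (Fin.last (n + 1))) (hy : 0 ≤ y (Fin.last (n + 1)))
    (hr : ‖x‖ ≤ r) (hy2 : ‖y‖ ≤ 2 * r) :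
    |oddBump 3 x r y - 12 * x (Fin.last (n + 1)) * (y (Fin.last (n + 1)) * bump 2 0 r y)| ≤
      120 * ‖x‖ * x (Fin.last (n + 1)) * r ^ 3 * y (Fin.last (n + 1)) := by
  have hr0 : 0 ≤ r := (norm_nonneg x).trans hr
  have hxy := mul_nonneg hx hy
  set b := 4 * x (Fin.last (n + 1)) * y (Fin.last (n + 1)) with hb
  have hb0 : 0 ≤ b := by rw [hb]; linarith
  set p := r ^ 2 - ‖y - x‖ ^ 2 with hp
  set q := r ^ 2 - ‖y - reflect x‖ ^ 2 with hq
  set s := r ^ 2 - ‖y‖ ^ 2 with hs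
  have hpq : p - q = b := by rw [hp, hq, norm_sub_reflect_sq]; ring
  have hle : q ≤ p := by linarith
  have hps : |p - s| ≤ 5 * ‖x‖ * r := abs_norm_sub_sq_sub_le hr hy2
  have hqs : |q - s| ≤ 5 * ‖x‖ * r := by
    have := abs_norm_sub_sq_sub_le (a := reflect x) (by rwa [norm_reflect]) hy2
    rwa [norm_reflect] at this
  have hpr : p ≤ r ^ 2 := by rw [hp]; linarith [sq_nonneg ‖y - x‖]
  have hqr : q ≤ r ^ 2 := hle.trans hpr
  have hsr : s ≤ r ^ 2 := by rw [hs]; linarith [sq_nonneg ‖y‖]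
  have h1 := (abs_max_zero_sq_sub_le hpr hsr (sq_nonneg r)).trans
    (mul_le_mul_of_nonneg_right hps (by positivity))
  have h2 := (abs_max_zero_sq_sub_le hqr hsr (sq_nonneg r)).trans
    (mul_le_mul_of_nonneg_right hqs (by positivity))
  have h3 := max_zero_cube_sub_le hle
  have h4 := le_max_zero_cube_sub hle
  rw [hpq] at h3 h4
  have e1 : oddBump 3 x r y = max p 0 ^ 3 - max q 0 ^ 3 := rfl
  have e2 : bump 2 0 r y = max s 0 ^ 2 := by simp [bump, hs]
  have e3 : 12 * x (Fin.last (n + 1)) * (y (Fin.last (n + 1)) * max s 0 ^ 2) =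
      3 * b * max s 0 ^ 2 := by rw [hb]; ring
  have e4 : 120 * ‖x‖ * x (Fin.last (n + 1)) * r ^ 3 * y (Fin.last (n + 1)) =
      3 * b * (5 * ‖x‖ * r * (2 * r ^ 2)) := by rw [hb]; ring
  rw [e1, e2, e3, e4, abs_le]
  have h5 := mul_le_mul_of_nonneg_left (abs_le.1 h1).2 (by linarith : 0 ≤ 3 * b)
  have h6 := mul_le_mul_of_nonneg_left (abs_le.1 h2).1 (by linarith : 0 ≤ 3 * b)
  constructor <;> linarith

theorem oddBump_eq_zero_of_two_mul_lt {k : ℕ} (hk : k ≠ 0) (hr : ‖x‖ ≤ r) (hy : 2 * r < ‖y‖) :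
    oddBump k x r y = 0 := by
  have h1 := norm_sub_norm_le y x
  have h2 := norm_sub_norm_le y (reflect x)
  rw [norm_reflect] at h2
  have hr0 : |r| = r := abs_of_nonneg ((norm_nonneg x).trans hr)
  rw [oddBump, bump_eq_zero hk (by linarith), bump_eq_zero hk (by linarith), sub_zero]

theorem oddBump_nonneg (k : ℕ) (hx : 0 ≤ x (Fin.last (n + 1))) (hy : 0 ≤ y (Fin.last (n + 1))) :
    0 ≤ oddBump k x r y := by
  have := mul_nonneg hx hy
  have h := norm_sub_reflect_sq x y
  rw [oddBump, sub_nonneg]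
  unfold bump
  gcongr ?_ ^ k
  exact max_le_max_right 0 (by linarith)

theorem le_oddBump_en (hr : 4 ≤ r) (hy : 0 ≤ y (Fin.last (n + 1))) (hy2 : ‖y‖ ≤ r / 2) :
    3 / 4 * r ^ 4 * y (Fin.last (n + 1)) ≤ oddBump 3 (en n) r y := by
  have hn : ‖en n‖ = 1 := by simpa using norm_smul_en n 1
  set p := r ^ 2 - ‖y - en n‖ ^ 2 with hp
  set q := r ^ 2 - ‖y - reflect (en n)‖ ^ 2 with hq
  have hpq : p - q = 4 * y (Fin.last (n + 1)) := by
    rw [hp, hq, norm_sub_reflect_sq, en_last]; ring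
  have h := le_max_zero_cube_sub (show q ≤ p by linarith)
  have e : oddBump 3 (en n) r y = max p 0 ^ 3 - max q 0 ^ 3 := rfl
  have hq4 : r ^ 2 / 4 ≤ q := by
    have h1 := norm_sub_le y (reflect (en n))
    rw [norm_reflect, hn] at h1
    have h2 : ‖y - reflect (en n)‖ ≤ 3 / 4 * r := by linarith
    have h3 := pow_le_pow_left₀ (norm_nonneg _) h2 2
    rw [hq]
    nlinarith
  have h5 : (r ^ 2 / 4) ^ 2 ≤ max q 0 ^ 2 :=
    pow_le_pow_left₀ (by positivity) (hq4.trans (le_max_left _ _)) 2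
  rw [e]
  refine le_trans ?_ h
  rw [hpq]
  have := mul_le_mul_of_nonneg_left h5 (by linarith : 0 ≤ 3 * (4 * y (Fin.last (n + 1))))
  linarith

end Asymptotics

section Liouville

variable {n : ℕ} {u : EuclideanSpace ℝ (Fin (n + 2)) → ℝ}

theorem integrableOn_mul_of_isCompact
    (hcont : ContinuousOn u {x | 0 ≤ x (Fin.last (n + 1))}) (r : ℝ)
    {g : EuclideanSpace ℝ (Fin (n + 2)) → ℝ} (hg : Continuous g) :
    IntegrableOn (fun y => u y * g y)
      ({y | 0 < y (Fin.last (n + 1))} ∩ Metric.closedBall 0 r) := by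
  have hcl : IsClosed {x : EuclideanSpace ℝ (Fin (n + 2)) | 0 ≤ x (Fin.last (n + 1))} :=
    isClosed_le continuous_const (by fun_prop)
  have h : IntegrableOn (fun y => u y * g y)
      ({x | 0 ≤ x (Fin.last (n + 1))} ∩ Metric.closedBall 0 r) :=
    ((hcont.mono inter_subset_left).mul hg.continuousOn).integrableOn_compact
      ((isCompact_closedBall _ _).inter_left hcl)
  exact h.mono_set (inter_subset_inter_left _
    fun y (hy : 0 < y (Fin.last (n + 1))) => hy.le)

theorem setIntegral_mul_last_le
    (hcont : ContinuousOn u {x | 0 ≤ x (Fin.last (n + 1))})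
    (hharm : IsHarmonicOn u {x | 0 < x (Fin.last (n + 1))})
    (hnonneg : ∀ x : EuclideanSpace ℝ (Fin (n + 2)), 0 ≤ x (Fin.last (n + 1)) → 0 ≤ u x)
    (hbd : ∀ x : EuclideanSpace ℝ (Fin (n + 2)), x (Fin.last (n + 1)) = 0 → u x = 0) :
    ∃ K, ∀ r : ℝ, 1 ≤ r →
      ∫ y in {y | 0 < y (Fin.last (n + 1))} ∩ Metric.closedBall 0 (2 * r),
        u y * y (Fin.last (n + 1)) ≤ K * r ^ (n + 4) := by
  set L := Fin.last (n + 1) with hL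
  set H : Set (EuclideanSpace ℝ (Fin (n + 2))) := {y | 0 < y L} with hH
  have hHo : IsOpen H := isOpen_setOf_pos_apply _
  set c := ∫ y, bump 3 (0 : EuclideanSpace ℝ (Fin (n + 2))) 1 y with hc
  refine ⟨4 / 3 * (c * u (en n) * 4 ^ (n + 4)), fun r hr => ?_⟩
  have hR : 0 < 4 * r := by linarith
  have he : 0 < en n L := by rw [hL, en_last]; exact one_pos
  have h1 := setIntegral_oddBump_eq hcont hharm hbd (x := en n) he hR
  have hi := integrableOn_mul_of_hasCompactSupport hcont (continuous_oddBump 3 (en n) (4 * r))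
    (hasCompactSupport_oddBump (en n) (4 * r) (by norm_num))
  have h2 : ∫ y in H ∩ Metric.closedBall 0 (2 * r), 3 / 4 * (4 * r) ^ 4 * (u y * y L) ≤
      ∫ y in H ∩ Metric.closedBall 0 (2 * r), u y * oddBump 3 (en n) (4 * r) y := by
    refine setIntegral_mono_on
      ((integrableOn_mul_of_isCompact hcont _ (by fun_prop)).const_mul _)
      (hi.mono_set inter_subset_left)
      (hHo.measurableSet.inter Metric.isClosed_closedBall.measurableSet) ?_
    rintro y ⟨hy : 0 < y L, hy2⟩
    rw [mem_closedBall_zero_iff] at hy2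
    have := mul_le_mul_of_nonneg_left
      (le_oddBump_en (r := 4 * r) (by linarith) hy.le (by linarith)) (hnonneg y hy.le)
    linarith
  have h3 : ∫ y in H ∩ Metric.closedBall 0 (2 * r), u y * oddBump 3 (en n) (4 * r) y ≤
      ∫ y in H, u y * oddBump 3 (en n) (4 * r) y := by
    refine setIntegral_mono_set hi ?_ (Eventually.of_forall inter_subset_left)
    filter_upwards [ae_restrict_mem hHo.measurableSet] with y (hy : 0 < y L)
    exact mul_nonneg (hnonneg y hy.le) (oddBump_nonneg 3 he.le hy.le)
  rw [integral_const_mul] at h2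
  have h4 := h2.trans (h3.trans h1.le)
  have hp : 0 < 3 / 4 * (4 * r) ^ 4 := by positivity
  refine le_of_mul_le_mul_left (h4.trans (le_of_eq ?_)) hp
  ring

theorem abs_mean_sub_le
    (hcont : ContinuousOn u {x | 0 ≤ x (Fin.last (n + 1))})
    (hharm : IsHarmonicOn u {x | 0 < x (Fin.last (n + 1))})
    (hnonneg : ∀ x : EuclideanSpace ℝ (Fin (n + 2)), 0 ≤ x (Fin.last (n + 1)) → 0 ≤ u x)
    (hbd : ∀ x : EuclideanSpace ℝ (Fin (n + 2)), x (Fin.last (n + 1)) = 0 → u x = 0)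
    {x : EuclideanSpace ℝ (Fin (n + 2))} (hx : 0 < x (Fin.last (n + 1))) {r : ℝ} (hr : 0 < r)
    (hxr : ‖x‖ ≤ r) :
    |(∫ y, bump 3 (0 : EuclideanSpace ℝ (Fin (n + 2))) 1 y) * u x * r ^ (n + 8) -
      12 * x (Fin.last (n + 1)) *
        ∫ y in {y | 0 < y (Fin.last (n + 1))} ∩ Metric.closedBall 0 (2 * r),
          u y * (y (Fin.last (n + 1)) * bump 2 0 r y)| ≤
      120 * ‖x‖ * x (Fin.last (n + 1)) * r ^ 3 *
        ∫ y in {y | 0 < y (Fin.last (n + 1))} ∩ Metric.closedBall 0 (2 * r),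
          u y * y (Fin.last (n + 1)) := by
  set L := Fin.last (n + 1) with hL
  set H : Set (EuclideanSpace ℝ (Fin (n + 2))) := {y | 0 < y L} with hH
  have hHo : IsOpen H := isOpen_setOf_pos_apply _
  have hms : MeasurableSet (H ∩ Metric.closedBall 0 (2 * r)) :=
    hHo.measurableSet.inter Metric.isClosed_closedBall.measurableSet
  have h1 : ∫ y in H ∩ Metric.closedBall 0 (2 * r), u y * oddBump 3 x r y =
      ∫ y in H, u y * oddBump 3 x r y := by
    symm
    refine setIntegral_eq_of_subset_of_forall_sdiff_eq_zero hHo.measurableSet inter_subset_left ?_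
    rintro y ⟨hy, hy2⟩
    have : 2 * r < ‖y‖ := by
      by_contra hlt
      exact hy2 ⟨hy, by simpa using hlt⟩
    rw [oddBump_eq_zero_of_two_mul_lt (by norm_num) hxr this, mul_zero]
  have hb := continuous_bump 2 (0 : EuclideanSpace ℝ (Fin (n + 2))) r
  rw [← setIntegral_oddBump_eq hcont hharm hbd hx hr, ← h1, ← integral_const_mul,
    ← integral_const_mul, ← integral_sub
      (integrableOn_mul_of_isCompact hcont _ (continuous_oddBump 3 x r))
      ((integrableOn_mul_of_isCompact hcont _ (by fun_prop)).const_mul _), ← Real.norm_eq_abs]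
  refine norm_integral_le_of_norm_le
    ((integrableOn_mul_of_isCompact hcont _ (by fun_prop)).const_mul _) ?_
  filter_upwards [ae_restrict_mem hms] with y hy
  have hy0 : 0 < y L := hy.1
  have hy2 : ‖y‖ ≤ 2 * r := by simpa using hy.2
  have h := mul_le_mul_of_nonneg_left (abs_oddBump_sub_le hx.le hy0.le hxr hy2)
    (hnonneg y hy0.le)
  rw [Real.norm_eq_abs, show u y * oddBump 3 x r y - 12 * x L * (u y * (y L * bump 2 0 r y)) =
    u y * (oddBump 3 x r y - 12 * x L * (y L * bump 2 0 r y)) by ring, abs_mul,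
    abs_of_nonneg (hnonneg y hy0.le)]
  linarith

end Liouville

theorem liouville_typeII_halfspace (n : ℕ) (u : EuclideanSpace ℝ (Fin (n + 2)) → ℝ)
    (hcont : ContinuousOn u {x | 0 ≤ x (Fin.last (n + 1))})
    (hharm : IsHarmonicOn u {x | 0 < x (Fin.last (n + 1))})
    (hnonneg : ∀ x : EuclideanSpace ℝ (Fin (n + 2)), 0 ≤ x (Fin.last (n + 1)) → 0 ≤ u x)
    (hbd : ∀ x : EuclideanSpace ℝ (Fin (n + 2)), x (Fin.last (n + 1)) = 0 → u x = 0) :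
    ∀ x : EuclideanSpace ℝ (Fin (n + 2)), 0 ≤ x (Fin.last (n + 1)) →
      u x = u (en n) * x (Fin.last (n + 1)) := by
  intro x hx
  rcases hx.eq_or_lt with hx0 | hx0
  · rw [hbd x hx0.symm, ← hx0, mul_zero]
  set c := ∫ y, bump 3 (0 : EuclideanSpace ℝ (Fin (n + 2))) 1 y with hc
  have hc0 : 0 < c := integral_bump_pos (by norm_num)
  obtain ⟨K, hK⟩ := setIntegral_mul_last_le hcont hharm hnonneg hbd
  set B := 120 * (‖x‖ + 1) * x (Fin.last (n + 1)) * K with hB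
  have hn : ‖en n‖ = 1 := by simpa using norm_smul_en n 1
  have main (r : ℝ) (hr1 : 1 ≤ r) (hxr : ‖x‖ ≤ r) :
      |c * (u x - u (en n) * x (Fin.last (n + 1)))| ≤ B / r := by
    have hr : 0 < r := by linarith
    have h1 := abs_mean_sub_le hcont hharm hnonneg hbd hx0 hr hxr
    have h2 := abs_mean_sub_le hcont hharm hnonneg hbd (x := en n)
      (by rw [en_last]; exact one_pos) hr (hn.trans_le hr1)
    rw [en_last, hn] at h2
    have h3 := hK r hr1
    rw [← hc] at h1 h2
    set T := ∫ y in {y | 0 < y (Fin.last (n + 1))} ∩ Metric.closedBall 0 (2 * r),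
      u y * (y (Fin.last (n + 1)) * bump 2 0 r y) with hT
    set W := ∫ y in {y | 0 < y (Fin.last (n + 1))} ∩ Metric.closedBall 0 (2 * r),
      u y * y (Fin.last (n + 1)) with hW
    set ξ := x (Fin.last (n + 1)) with hξ
    have h4 : |c * (u x - u (en n) * ξ) * r ^ (n + 8)| ≤
        120 * (‖x‖ + 1) * ξ * r ^ 3 * W := by
      have h5 := abs_le.1 h1
      have h6 := mul_le_mul_of_nonneg_left (abs_le.1 h2).1 hx
      have h7 := mul_le_mul_of_nonneg_left (abs_le.1 h2).2 hx
      rw [abs_le]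
      constructor <;> linarith [h5.1, h5.2]
    have h8 : 120 * (‖x‖ + 1) * ξ * r ^ 3 * W ≤ B / r * r ^ (n + 8) := by
      calc 120 * (‖x‖ + 1) * ξ * r ^ 3 * W
          ≤ 120 * (‖x‖ + 1) * ξ * r ^ 3 * (K * r ^ (n + 4)) := by gcongr
        _ = B / r * r ^ (n + 8) := by
          rw [hB]; field_simp; ring
    rw [abs_mul, abs_of_pos (by positivity : 0 < r ^ (n + 8))] at h4
    exact le_of_mul_le_mul_right (h4.trans h8) (by positivity)
  have hlim : Tendsto (fun r : ℝ => B / r) atTop (𝓝 0) := tendsto_const_nhds.div_atTop tendsto_id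
  have h0 : |c * (u x - u (en n) * x (Fin.last (n + 1)))| ≤ 0 := by
    refine ge_of_tendsto hlim ?_
    filter_upwards [eventually_ge_atTop 1, eventually_ge_atTop ‖x‖] with r h1 h2 using main r h1 h2
  have h1 := abs_nonpos_iff.1 h0
  exact sub_eq_zero.1 ((mul_eq_zero.1 h1).resolve_left hc0.ne')
end
end
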